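/- arXiv:2301.09086 — 3 statements merged into one kernel-verified Lean document; each statement's English description precedes it below -/
import Mathlib

section
/- Let u be a classical solution of the wave equation on 0 < x < ℓ(t) with u(0,t) = 0 and the damped boundary condition (1 + η ℓ′(t)) u_x(ℓ(t),t) + (η + ℓ′(t)) u_t(ℓ(t),t) = 0, with η > 0, η ≠ 1, and let φ satisfy Moore's equation with φ′ > 0. Then the quantity Q_η(t) = ∫₀^{ℓ(t)} [ (e^{ln|γ_η| φ(t+x)}/φ′(t+x) + e^{ln|γ_η| φ(t−x)}/φ′(t−x))(u_x² + u_t²) + 2(e^{ln|γ_η| φ(t+x)}/φ′(t+x) − e^{ln|γ_η| φ(t−x)}/φ′(t−x)) u_x u_t ] dx is independent of t, i.e. Q_η(t) = Q_η(0) for all t ≥ 0. -/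
open Set

/-- A function with vanishing directional derivative along a segment takes the same value at
both ends. -/
lemma eq_of_fderiv_apply_eq_zero_on_segment {E : Type*} [NormedAddCommGroup E] [NormedSpace ℝ E]
    {g : E → ℝ} {p d : E} {R : ℝ} (hR : 0 ≤ R)
    (hg : ∀ r ∈ Icc 0 R, DifferentiableAt ℝ g (p + r • d))
    (hd : ∀ r ∈ Icc 0 R, fderiv ℝ g (p + r • d) d = 0) :
    g (p + R • d) = g p := by
  have key : ∀ r ∈ Icc 0 R, HasDerivAt (fun r : ℝ => g (p + r • d)) 0 r := by
    intro r hr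
    have h1 : HasDerivAt (fun r : ℝ => p + r • d) d r := by
      simpa using ((hasDerivAt_id r).smul_const d).const_add p
    have h2 := (hg r hr).hasFDerivAt.comp_hasDerivAt r h1
    rwa [hd r hr] at h2
  have h := constant_of_has_deriv_right_zero (f := fun r : ℝ => g (p + r • d)) (a := 0) (b := R)
    (fun r hr => (key r hr).continuousAt.continuousWithinAt)
    (fun r hr => (key r (Ico_subset_Icc_self hr)).hasDerivWithinAt) R (right_mem_Icc.2 hR)
  simpa using h

section Plane

variable {f : ℝ × ℝ → ℝ} {U : Set (ℝ × ℝ)}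

lemma hasDerivAt_fst_slice {x t : ℝ} (hf : DifferentiableAt ℝ f (x, t)) :
    HasDerivAt (fun y => f (y, t)) (fderiv ℝ f (x, t) (1, 0)) x :=
  hf.hasFDerivAt.comp_hasDerivAt x ((hasDerivAt_id x).prodMk (hasDerivAt_const x t))

lemma hasDerivAt_snd_slice {x t : ℝ} (hf : DifferentiableAt ℝ f (x, t)) :
    HasDerivAt (fun s => f (x, s)) (fderiv ℝ f (x, t) (0, 1)) t :=
  hf.hasFDerivAt.comp_hasDerivAt t ((hasDerivAt_const t x).prodMk (hasDerivAt_id t))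

lemma hasFDerivAt_fderiv_apply {p : ℝ × ℝ} (hf : ContDiffAt ℝ 2 f p) (e : ℝ × ℝ) :
    HasFDerivAt (fun q => fderiv ℝ f q e) ((fderiv ℝ (fderiv ℝ f) p).flip e) p := by
  have h : DifferentiableAt ℝ (fderiv ℝ f) p :=
    (hf.fderiv_right (m := 1) (by norm_num)).differentiableAt (by norm_num)
  simpa using h.hasFDerivAt.clm_apply (hasFDerivAt_const e p)

lemma deriv_deriv_fst_slice (hU : IsOpen U) (hf : ContDiffOn ℝ 2 f U) {x t : ℝ}
    (hp : (x, t) ∈ U) :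
    deriv (deriv (fun y => f (y, t))) x = fderiv ℝ (fderiv ℝ f) (x, t) (1, 0) (1, 0) := by
  have hev : ∀ᶠ y in nhds x, (y, t) ∈ U :=
    (Continuous.prodMk_left t).continuousAt.eventually_mem (hU.mem_nhds hp)
  have heq : deriv (fun y => f (y, t)) =ᶠ[nhds x] fun y => fderiv ℝ f (y, t) (1, 0) := by
    filter_upwards [hev] with y hy
    exact (hasDerivAt_fst_slice
      ((hf.contDiffAt (hU.mem_nhds hy)).differentiableAt (by norm_num))).deriv
  have h := hasFDerivAt_fderiv_apply (hf.contDiffAt (hU.mem_nhds hp)) (1, 0)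
  rw [heq.deriv_eq, (hasDerivAt_fst_slice h.differentiableAt).deriv, h.fderiv]
  rfl

lemma deriv_deriv_snd_slice (hU : IsOpen U) (hf : ContDiffOn ℝ 2 f U) {x t : ℝ}
    (hp : (x, t) ∈ U) :
    deriv (deriv (fun s => f (x, s))) t = fderiv ℝ (fderiv ℝ f) (x, t) (0, 1) (0, 1) := by
  have hev : ∀ᶠ s in nhds t, (x, s) ∈ U :=
    (Continuous.prodMk_right x).continuousAt.eventually_mem (hU.mem_nhds hp)
  have heq : deriv (fun s => f (x, s)) =ᶠ[nhds t] fun s => fderiv ℝ f (x, s) (0, 1) := by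
    filter_upwards [hev] with s hs
    exact (hasDerivAt_snd_slice
      ((hf.contDiffAt (hU.mem_nhds hs)).differentiableAt (by norm_num))).deriv
  have h := hasFDerivAt_fderiv_apply (hf.contDiffAt (hU.mem_nhds hp)) (0, 1)
  rw [heq.deriv_eq, (hasDerivAt_snd_slice h.differentiableAt).deriv, h.fderiv]
  rfl

/-- For a solution of the wave equation at `p`, the mixed second derivative in the two
characteristic directions vanishes. -/
lemma fderiv_fderiv_characteristic {p : ℝ × ℝ} (hf : ContDiffAt ℝ 2 f p)
    (hw : fderiv ℝ (fderiv ℝ f) p (0, 1) (0, 1) = fderiv ℝ (fderiv ℝ f) p (1, 0) (1, 0)) :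
    fderiv ℝ (fderiv ℝ f) p (1, -1) (1, 1) = 0 ∧
      fderiv ℝ (fderiv ℝ f) p (1, 1) (1, -1) = 0 := by
  have hs : IsSymmSndFDerivAt ℝ f p := hf.isSymmSndFDerivAt (by simp)
  have h1 := hs.eq (1, 0) (0, 1)
  have h2 := hs.eq (1, -1) (1, 1)
  have e1 : ((1 : ℝ), (1 : ℝ)) = (1, 0) + (0, 1) := by simp
  have e2 : ((1 : ℝ), (-1 : ℝ)) = (1, 0) - (0, 1) := by simp
  rw [← h2, and_self, e1, e2]
  simp only [map_add, map_sub, sub_apply]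
  linarith

end Plane

/-- A function whose derivative has absolute value less than one strictly contracts distances. -/
lemma abs_sub_lt_of_abs_deriv_lt_one {ℓ ℓ' : ℝ → ℝ}
    (hd : ∀ t ∈ Ici (0:ℝ), HasDerivWithinAt ℓ (ℓ' t) (Ici 0) t)
    (hs : ∀ t ∈ Ici (0:ℝ), |ℓ' t| < 1) {a b : ℝ} (ha : 0 ≤ a) (hab : a < b) :
    |ℓ b - ℓ a| < b - a := by
  obtain ⟨c, hc, h⟩ := exists_hasDerivAt_eq_slope ℓ ℓ' hab
    (fun t ht => ((hd t (ha.trans ht.1)).continuousWithinAt).mono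
      fun s hs => ha.trans hs.1)
    (fun t ht => (hd t (ha.trans ht.1.le)).hasDerivAt (Ici_mem_nhds (ha.trans_lt ht.1)))
  have h1 := hs c (ha.trans hc.1.le)
  rwa [h, abs_div, abs_of_pos (sub_pos.2 hab), div_lt_one (sub_pos.2 hab)] at h1

/-- The algebraic identity behind the conservation law: the fluxes through the two ends of the
moving window agree. -/
lemma boundary_flux_balance {η γ k A B a b P M : ℝ} (hη1 : η ≠ 1) (hη0 : 0 < η)
    (hγ : γ = (1 + η) / (1 - η)) (hk : |k| < 1) (ha : 0 < a) (hb : 0 < b)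
    (hbc : (1 + η * k) * ((A + B) / 2) + (η + k) * ((A - B) / 2) = 0)
    (hder : a * (1 + k) = b * (1 - k)) (hP : P = M + 2) :
    Real.exp (Real.log |γ| * P) / a * A ^ 2 * (1 + k)
      = Real.exp (Real.log |γ| * M) / b * B ^ 2 * (1 - k) := by
  have h1η : 1 - η ≠ 0 := sub_ne_zero.2 hη1.symm
  have hγ0 : γ ≠ 0 := by
    rw [hγ]; exact div_ne_zero (by positivity) h1η
  have hexp : Real.exp (Real.log |γ| * P) = Real.exp (Real.log |γ| * M) * γ ^ 2 := by
    rw [hP, mul_add, Real.exp_add, mul_comm (Real.log |γ|) 2, ← sq_abs γ]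
    congr 1
    rw [two_mul, Real.exp_add, Real.exp_log (abs_pos.2 hγ0), sq]
  have hk2 := abs_lt.1 hk
  have hAB : γ * A * (1 + k) = -(B * (1 - k)) := by
    rw [hγ]; field_simp; linarith
  rw [hexp]
  generalize Real.exp (Real.log |γ| * M) = E
  have hk' : 1 - k ≠ 0 := by linarith
  have hsq : (γ * A * (1 + k)) ^ 2 = (B * (1 - k)) ^ 2 := by rw [hAB]; ring
  field_simp
  apply mul_right_cancel₀ hk'
  linear_combination E * a * hsq - E * γ ^ 2 * A ^ 2 * (1 + k) * hder

theorem damped_conserved_quantity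
    (L : ℝ) (ℓ ℓ' : ℝ → ℝ)
    (hℓC1 : ContDiffOn ℝ 1 ℓ (Set.Ici 0))
    (hℓd : ∀ t ∈ Set.Ici (0:ℝ), HasDerivWithinAt ℓ (ℓ' t) (Set.Ici 0) t)
    (hℓpos : ∀ t ∈ Set.Ici (0:ℝ), 0 < ℓ t)
    (hℓspeed : ∀ t ∈ Set.Ici (0:ℝ), |ℓ' t| < 1)
    (hL : ℓ 0 = L)
    (u : ℝ → ℝ → ℝ) (U : Set (ℝ × ℝ)) (hUopen : IsOpen U)
    (hUK : {p : ℝ × ℝ | 0 ≤ p.2 ∧ p.1 ∈ Set.Icc 0 (ℓ p.2)} ⊆ U)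
    (huC2 : ContDiffOn ℝ 2 (fun p : ℝ × ℝ => u p.1 p.2) U)
    (hwave : ∀ x t : ℝ, 0 ≤ t → x ∈ Set.Icc 0 (ℓ t) →
      deriv (deriv (u x)) t = deriv (deriv (fun y => u y t)) x)
    (hbc0 : ∀ t : ℝ, 0 ≤ t → u 0 t = 0)
    (η : ℝ) (hη0 : 0 < η) (hη1 : η ≠ 1)
    (hbcℓ : ∀ t : ℝ, 0 < t →
      (1 + η * ℓ' t) * deriv (fun y => u y t) (ℓ t)
        + (η + ℓ' t) * deriv (u (ℓ t)) t = 0)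
    (φ φ' : ℝ → ℝ)
    (hφC1 : ContDiffOn ℝ 1 φ (Set.Ici (-L)))
    (hφd : ∀ s ∈ Set.Ici (-L), HasDerivWithinAt φ (φ' s) (Set.Ici (-L)) s)
    (hφpos : ∀ s ∈ Set.Ici (-L), 0 < φ' s)
    (hMoore : ∀ t ∈ Set.Ici (0:ℝ), φ (t + ℓ t) - φ (t - ℓ t) = 2)
    (γ : ℝ) (hγ : γ = (1 + η) / (1 - η))
    (Q : ℝ → ℝ)
    (hQ : ∀ t : ℝ, Q t = ∫ x in (0:ℝ)..(ℓ t),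
      ((Real.exp (Real.log |γ| * φ (t + x)) / φ' (t + x)
          + Real.exp (Real.log |γ| * φ (t - x)) / φ' (t - x))
          * ((deriv (fun y => u y t) x)^2 + (deriv (u x) t)^2)
        + 2 * (Real.exp (Real.log |γ| * φ (t + x)) / φ' (t + x)
          - Real.exp (Real.log |γ| * φ (t - x)) / φ' (t - x))
          * (deriv (fun y => u y t) x * deriv (u x) t)))
    : ∀ t ∈ Set.Ici (0:ℝ), Q t = Q 0 := by
  set f : ℝ × ℝ → ℝ := fun p => u p.1 p.2 with hf
  set K : Set (ℝ × ℝ) := {p : ℝ × ℝ | 0 ≤ p.2 ∧ p.1 ∈ Icc 0 (ℓ p.2)} with hK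
  have hC2 : ∀ p ∈ K, ContDiffAt ℝ 2 f p := fun p hp =>
    huC2.contDiffAt (hUopen.mem_nhds (hUK hp))
  have hdiff : ∀ p ∈ K, DifferentiableAt ℝ f p := fun p hp =>
    (hC2 p hp).differentiableAt (by norm_num)
  have hux : ∀ x t, (x, t) ∈ K → deriv (fun y => u y t) x = fderiv ℝ f (x, t) (1, 0) :=
    fun x t hp => (hasDerivAt_fst_slice (hdiff _ hp)).deriv
  have hut : ∀ x t, (x, t) ∈ K → deriv (u x) t = fderiv ℝ f (x, t) (0, 1) :=
    fun x t hp => (hasDerivAt_snd_slice (hdiff _ hp)).deriv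
  have hchar : ∀ p ∈ K, fderiv ℝ (fderiv ℝ f) p (1, -1) (1, 1) = 0 ∧
      fderiv ℝ (fderiv ℝ f) p (1, 1) (1, -1) = 0 := by
    rintro ⟨x, t⟩ hp
    refine fderiv_fderiv_characteristic (hC2 _ hp) ?_
    rw [← deriv_deriv_fst_slice hUopen huC2 (hUK hp), ← deriv_deriv_snd_slice hUopen huC2 (hUK hp)]
    exact hwave x t hp.1 hp.2
  have hlip : ∀ a b, 0 ≤ a → a ≤ b → |ℓ b - ℓ a| ≤ b - a := by
    intro a b ha hab
    rcases hab.eq_or_lt with rfl | h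
    · simp
    · exact (abs_sub_lt_of_abs_deriv_lt_one hℓd hℓspeed ha h).le
  -- The Riemann invariants `w = u_x + u_t` and `v = u_x - u_t`.
  set w : ℝ × ℝ → ℝ := fun p => fderiv ℝ f p (1, 1) with hw
  set v : ℝ × ℝ → ℝ := fun p => fderiv ℝ f p (1, -1) with hv
  have hw_eq : ∀ x t, (x, t) ∈ K → w (x, t) = deriv (fun y => u y t) x + deriv (u x) t := by
    intro x t hp
    rw [hux x t hp, hut x t hp, ← map_add]
    simp [hw]
  have hv_eq : ∀ x t, (x, t) ∈ K → v (x, t) = deriv (fun y => u y t) x - deriv (u x) t := by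
    intro x t hp
    rw [hux x t hp, hut x t hp, ← map_sub]
    simp [hv]
  have hw_char : ∀ x t, (x, t) ∈ K → w (x, t) = w (0, t + x) := by
    intro x t hp
    have hx : 0 ≤ x := hp.2.1
    have ht : 0 ≤ t := hp.1
    have hmem : ∀ r ∈ Icc 0 x, (0, t + x) + r • ((1 : ℝ), (-1 : ℝ)) ∈ K := by
      intro r hr
      have h1 := abs_le.1 (hlip t (t + x - r) ht (by linarith [hr.2]))
      have h2 : x ≤ ℓ t := hp.2.2
      simp only [hK, mem_ofPred_eq, Prod.smul_mk, Prod.mk_add_mk, smul_eq_mul, mem_Icc, mul_one,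
        mul_neg, zero_add, ← sub_eq_add_neg]
      exact ⟨by linarith [hr.2], hr.1, by linarith [h1.1]⟩
    have h := eq_of_fderiv_apply_eq_zero_on_segment (g := w) hx
      (fun r hr => (hasFDerivAt_fderiv_apply (hC2 _ (hmem r hr)) (1, 1)).differentiableAt)
      (fun r hr => by
        rw [(hasFDerivAt_fderiv_apply (hC2 _ (hmem r hr)) (1, 1)).fderiv]
        exact (hchar _ (hmem r hr)).1)
    simpa using h
  have hv_char : ∀ x t R, (x, t) ∈ K → 0 ≤ R → R ≤ x → R ≤ t →
      v (x, t) = v (x - R, t - R) := by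
    intro x t R hp hR hRx hRt
    have hmem : ∀ r ∈ Icc 0 R, (x - R, t - R) + r • ((1 : ℝ), (1 : ℝ)) ∈ K := by
      intro r hr
      have h1 := abs_le.1 (hlip (t - R + r) t (by linarith [hr.1]) (by linarith [hr.2]))
      have h2 : x ≤ ℓ t := hp.2.2
      simp only [hK, mem_ofPred_eq, Prod.smul_mk, Prod.mk_add_mk, smul_eq_mul, mem_Icc, mul_one]
      exact ⟨by linarith [hr.1], by linarith [hr.1], by linarith [h1.2]⟩
    have h := eq_of_fderiv_apply_eq_zero_on_segment (g := v) hR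
      (fun r hr => (hasFDerivAt_fderiv_apply (hC2 _ (hmem r hr)) (1, -1)).differentiableAt)
      (fun r hr => by
        rw [(hasFDerivAt_fderiv_apply (hC2 _ (hmem r hr)) (1, -1)).fderiv]
        exact (hchar _ (hmem r hr)).2)
    simpa using h
  have hK0 : ∀ t, 0 ≤ t → ((0 : ℝ), t) ∈ K := fun t ht => ⟨ht, le_rfl, (hℓpos t ht).le⟩
  have hwv0 : ∀ t, 0 ≤ t → w (0, t) = v (0, t) := by
    intro t ht
    have hp := hK0 t ht
    have h0 : deriv (u 0) t = 0 := by
      have h1 : HasDerivWithinAt (u 0) (deriv (u 0) t) (Ici 0) t :=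
        (hasDerivAt_snd_slice (hdiff _ hp)).differentiableAt.hasDerivAt.hasDerivWithinAt
      have h2 : HasDerivWithinAt (u 0) 0 (Ici 0) t :=
        (hasDerivWithinAt_const t (Ici 0) (0 : ℝ)).congr (fun s hs => hbc0 s hs) (hbc0 t ht)
      exact (uniqueDiffOn_Ici (0 : ℝ) t ht).eq_deriv _ h1 h2
    rw [hw_eq _ _ hp, hv_eq _ _ hp, h0, add_zero, sub_zero]
  -- The common profile of the two invariants.
  set G : ℝ → ℝ := fun s => v (max (-s) 0, max s 0) with hG
  have hwG : ∀ x t, (x, t) ∈ K → w (x, t) = G (t + x) := by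
    intro x t hp
    have h : 0 ≤ t + x := add_nonneg hp.1 hp.2.1
    rw [hw_char x t hp, hwv0 _ h, hG]
    simp only [max_eq_left h, max_eq_right (neg_nonpos.2 h)]
  have hvG : ∀ x t, (x, t) ∈ K → v (x, t) = G (t - x) := by
    intro x t hp
    rw [hG]
    rcases le_total x t with h | h
    · rw [hv_char x t x hp hp.2.1 le_rfl h]
      simp [h]
    · rw [hv_char x t t hp hp.1 h le_rfl]
      simp [h]
  have hGcont : ContinuousOn G (Ici (-L)) := by
    intro s hs
    have hmem : (max (-s) 0, max s 0) ∈ K := by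
      rcases le_total 0 s with h | h
      · rw [max_eq_left h, max_eq_right (neg_nonpos.2 h)]
        exact hK0 s h
      · rw [max_eq_right h, max_eq_left (neg_nonneg.2 h)]
        refine ⟨le_rfl, neg_nonneg.2 h, ?_⟩
        rw [hL]
        linarith [mem_Ici.1 hs]
    have h1 : ContinuousAt v (max (-s) 0, max s 0) :=
      (hasFDerivAt_fderiv_apply (hC2 _ hmem) (1, -1)).continuousAt
    have h2 : ContinuousAt (fun s : ℝ => (max (-s) 0, max s 0)) s := by fun_prop
    exact (ContinuousAt.comp (f := fun s : ℝ => (max (-s) 0, max s 0)) h1 h2).continuousWithinAt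
  have hφ'cont : ContinuousOn φ' (Ici (-L)) :=
    (hφC1.continuousOn_derivWithin (uniqueDiffOn_Ici _) (by norm_num)).congr fun s hs =>
      ((hφd s hs).derivWithin (uniqueDiffOn_Ici _ s hs)).symm
  set H : ℝ → ℝ := fun s => Real.exp (Real.log |γ| * φ s) / φ' s * G s ^ 2 with hH
  have hHcont : ContinuousOn H (Ici (-L)) :=
    ((Real.continuous_exp.comp_continuousOn (continuousOn_const.mul hφC1.continuousOn)).div hφ'cont
      fun s hs => (hφpos s hs).ne').mul (hGcont.pow 2)
  set J : ℝ → ℝ := fun s => H (max s (-L)) with hJ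
  have hJcont : Continuous J :=
    hHcont.comp_continuous (by fun_prop) fun s => mem_Ici.2 (le_max_right _ _)
  have hJH : ∀ s, -L ≤ s → J s = H s := fun s hs => by simp only [hJ, max_eq_left hs]
  have hlow : ∀ t, 0 ≤ t → -L ≤ t - ℓ t := by
    intro t ht
    have := (abs_le.1 (hlip 0 t le_rfl ht)).2
    linarith
  have hPderiv : ∀ y, HasDerivAt (fun y => ∫ s in (0 : ℝ)..y, J s) (J y) y := fun y =>
    intervalIntegral.integral_hasDerivAt_right (hJcont.intervalIntegrable _ _)
      hJcont.stronglyMeasurable.stronglyMeasurableAtFilter hJcont.continuousAt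
  set P : ℝ → ℝ := fun y => ∫ s in (0 : ℝ)..y, J s with hP
  have hQP : ∀ t, 0 ≤ t → Q t = P (t + ℓ t) - P (t - ℓ t) := by
    intro t ht
    have hℓ0 := (hℓpos t ht).le
    have hcongr : Q t = ∫ x in (0 : ℝ)..(ℓ t), (J (t + x) + J (t - x)) := by
      rw [hQ t]
      refine intervalIntegral.integral_congr fun x hx => ?_
      rw [uIcc_of_le hℓ0] at hx
      have hp : (x, t) ∈ K := ⟨ht, hx⟩
      have h1 := hlow t ht
      rw [hJH (t + x) (by linarith [hx.1, hx.2]), hJH (t - x) (by linarith [hx.2]), hH]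
      simp only
      rw [← hwG x t hp, ← hvG x t hp, hw_eq x t hp, hv_eq x t hp]
      ring
    rw [hcongr, intervalIntegral.integral_add
      ((by fun_prop : Continuous fun x => J (t + x)).intervalIntegrable _ _)
      ((by fun_prop : Continuous fun x => J (t - x)).intervalIntegrable _ _),
      intervalIntegral.integral_comp_add_left, intervalIntegral.integral_comp_sub_left,
      add_zero, sub_zero, add_comm, intervalIntegral.integral_add_adjacent_intervals
        (hJcont.intervalIntegrable _ _) (hJcont.intervalIntegrable _ _), hP]
    exact (intervalIntegral.integral_interval_sub_left (hJcont.intervalIntegrable _ _)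
      (hJcont.intervalIntegrable _ _)).symm
  have hPcont : Continuous P := continuous_iff_continuousAt.2 fun y => (hPderiv y).continuousAt
  have hderiv : ∀ t, 0 < t → HasDerivAt (fun t => P (t + ℓ t) - P (t - ℓ t)) 0 t := by
    intro t ht
    have ht0 : t ∈ Ici (0 : ℝ) := ht.le
    have hℓt : HasDerivAt ℓ (ℓ' t) t := (hℓd t ht0).hasDerivAt (Ici_mem_nhds ht)
    have hplus : HasDerivAt (fun t => t + ℓ t) (1 + ℓ' t) t := (hasDerivAt_id t).add hℓt
    have hminus : HasDerivAt (fun t => t - ℓ t) (1 - ℓ' t) t := (hasDerivAt_id t).sub hℓt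
    have hlow' : -L < t - ℓ t := by
      have := (abs_lt.1 (abs_sub_lt_of_abs_deriv_lt_one hℓd hℓspeed le_rfl ht)).2
      linarith
    have hhigh : -L < t + ℓ t := by linarith [hℓpos t ht0]
    have hφplus := ((hφd _ hhigh.le).hasDerivAt (Ici_mem_nhds hhigh)).comp t hplus
    have hφminus := ((hφd _ hlow'.le).hasDerivAt (Ici_mem_nhds hlow')).comp t hminus
    have hMoore' : φ' (t + ℓ t) * (1 + ℓ' t) = φ' (t - ℓ t) * (1 - ℓ' t) := by
      have hconst : HasDerivAt (φ ∘ (fun t => t + ℓ t) - φ ∘ (fun t => t - ℓ t)) 0 t :=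
        (hasDerivAt_const t (2 : ℝ)).congr_of_eventuallyEq <| by
          filter_upwards [Ici_mem_nhds ht] with s hs using hMoore s hs
      exact sub_eq_zero.1 ((hφplus.sub hφminus).unique hconst)
    have hp : (ℓ t, t) ∈ K := ⟨ht.le, (hℓpos t ht0).le, le_rfl⟩
    have hA := hwG _ _ hp
    have hB := hvG _ _ hp
    rw [hw_eq _ _ hp] at hA
    rw [hv_eq _ _ hp] at hB
    have hflux := boundary_flux_balance (A := G (t + ℓ t)) (B := G (t - ℓ t)) hη1 hη0 hγ
      (hℓspeed t ht0) (hφpos _ hhigh.le) (hφpos _ hlow'.le)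
      (by rw [← hA, ← hB]; linear_combination hbcℓ t ht) hMoore'
      (sub_eq_iff_eq_add'.1 (hMoore t ht0))
    have h := ((hPderiv (t + ℓ t)).comp t hplus).sub ((hPderiv (t - ℓ t)).comp t hminus)
    rw [hJH _ hhigh.le, hJH _ hlow'.le, sub_eq_zero.2 hflux] at h
    exact h
  intro t ht
  rw [hQP t ht, hQP 0 le_rfl]
  rcases (mem_Ici.1 ht).eq_or_lt with rfl | hpos
  · rfl
  have hℓcont : ContinuousOn ℓ (Icc 0 t) := hℓC1.continuousOn.mono Icc_subset_Ici_self
  obtain ⟨c, -, hc⟩ := exists_hasDerivAt_eq_slope (fun t => P (t + ℓ t) - P (t - ℓ t)) (fun _ => 0)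
    hpos
    ((hPcont.comp_continuousOn (continuousOn_id.add hℓcont)).sub
      (hPcont.comp_continuousOn (continuousOn_id.sub hℓcont)))
    (fun s hs => hderiv s hs.1)
  rw [eq_comm, div_eq_zero_iff, or_iff_left (by linarith : t - 0 ≠ 0)] at hc
  exact sub_eq_zero.1 hc
end

section
/- In the damped case (η > 0, η ≠ 1, boundary condition (1 + η ℓ′(t)) u_x(ℓ(t),t) + (η + ℓ′(t)) u_t(ℓ(t),t) = 0), suppose φ′ is monotone on [t₀ − ℓ(t₀), t₁ + ℓ(t₁)] and −1 < ℓ′(t) ≤ 0 for all t ∈ [t₀,t₁]. Then φ′ is nondecreasing there and for all t ∈ [t₀,t₁]: (φ′(t − ℓ(t)) e^{−ln|γ_η| φ(t + ℓ(t))})/(φ′(t₀ + ℓ(t₀)) e^{−ln|γ_η| φ(t₀ − ℓ(t₀))}) · E(t₀) ≤ E(t) ≤ (φ′(t + ℓ(t)) e^{−ln|γ_η| φ(t − ℓ(t))})/(φ′(t₀ − ℓ(t₀)) e^{−ln|γ_η| φ(t₀ + ℓ(t₀))}) · E(t₀). -/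
open Set

/-! ### First and second order partial derivatives of a `C²` function -/

lemma deriv_left_eq_fderiv {u : ℝ → ℝ → ℝ} {x t : ℝ}
    (h : DifferentiableAt ℝ (fun p : ℝ × ℝ => u p.1 p.2) (x, t)) :
    deriv (fun y => u y t) x = fderiv ℝ (fun p : ℝ × ℝ => u p.1 p.2) (x, t) (1, 0) :=
  (h.hasFDerivAt.comp_hasDerivAt (f := fun y => (y, t)) x
    ((hasDerivAt_id x).prodMk (hasDerivAt_const x t))).deriv

lemma deriv_right_eq_fderiv {u : ℝ → ℝ → ℝ} {x t : ℝ}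
    (h : DifferentiableAt ℝ (fun p : ℝ × ℝ => u p.1 p.2) (x, t)) :
    deriv (u x) t = fderiv ℝ (fun p : ℝ × ℝ => u p.1 p.2) (x, t) (0, 1) :=
  (h.hasFDerivAt.comp_hasDerivAt (f := fun s => (x, s)) t
    ((hasDerivAt_const t x).prodMk (hasDerivAt_id t))).deriv

lemma differentiableAt_fderiv_of_contDiffOn {v : ℝ × ℝ → ℝ} {U : Set (ℝ × ℝ)} (hU : IsOpen U)
    (hv : ContDiffOn ℝ 2 v U) {p : ℝ × ℝ} (hp : p ∈ U) :
    DifferentiableAt ℝ (fderiv ℝ v) p :=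
  ((hv.fderiv_of_isOpen hU (m := 1) (by norm_num)).differentiableOn one_ne_zero).differentiableAt
    (hU.mem_nhds hp)

lemma deriv_deriv_left_eq_fderiv {u : ℝ → ℝ → ℝ} {U : Set (ℝ × ℝ)} (hU : IsOpen U)
    (hu : ContDiffOn ℝ 2 (fun p : ℝ × ℝ => u p.1 p.2) U) {x t : ℝ} (hp : (x, t) ∈ U) :
    deriv (deriv (fun y => u y t)) x =
      fderiv ℝ (fderiv ℝ (fun p : ℝ × ℝ => u p.1 p.2)) (x, t) (1, 0) (1, 0) := by
  have hev : deriv (fun y => u y t) =ᶠ[nhds x]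
      fun y => fderiv ℝ (fun p : ℝ × ℝ => u p.1 p.2) (y, t) (1, 0) := by
    have hc : Continuous fun y : ℝ => (y, t) := by fun_prop
    filter_upwards [hc.continuousAt.preimage_mem_nhds (hU.mem_nhds hp)] with y hy
    exact deriv_left_eq_fderiv
      ((hu.differentiableOn two_ne_zero).differentiableAt (hU.mem_nhds hy))
  rw [hev.deriv_eq]
  have h := (differentiableAt_fderiv_of_contDiffOn hU hu hp).hasFDerivAt.comp_hasDerivAt
    (f := fun y => (y, t)) x ((hasDerivAt_id x).prodMk (hasDerivAt_const x t))
  simpa using (h.clm_apply (hasDerivAt_const x ((1, 0) : ℝ × ℝ))).deriv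

lemma deriv_deriv_right_eq_fderiv {u : ℝ → ℝ → ℝ} {U : Set (ℝ × ℝ)} (hU : IsOpen U)
    (hu : ContDiffOn ℝ 2 (fun p : ℝ × ℝ => u p.1 p.2) U) {x t : ℝ} (hp : (x, t) ∈ U) :
    deriv (deriv (u x)) t =
      fderiv ℝ (fderiv ℝ (fun p : ℝ × ℝ => u p.1 p.2)) (x, t) (0, 1) (0, 1) := by
  have hev : deriv (u x) =ᶠ[nhds t]
      fun s => fderiv ℝ (fun p : ℝ × ℝ => u p.1 p.2) (x, s) (0, 1) := by
    have hc : Continuous fun s : ℝ => (x, s) := by fun_prop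
    filter_upwards [hc.continuousAt.preimage_mem_nhds (hU.mem_nhds hp)] with y hy
    exact deriv_right_eq_fderiv
      ((hu.differentiableOn two_ne_zero).differentiableAt (hU.mem_nhds hy))
  rw [hev.deriv_eq]
  have h := (differentiableAt_fderiv_of_contDiffOn hU hu hp).hasFDerivAt.comp_hasDerivAt
    (f := fun s => (x, s)) t ((hasDerivAt_const t x).prodMk (hasDerivAt_id t))
  simpa using (h.clm_apply (hasDerivAt_const t ((0, 1) : ℝ × ℝ))).deriv

/-- A `C²` solution of the wave equation: for `ε = ±1` the Riemann invariant `u_x - ε u_t` is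
stationary along the characteristic line of slope `ε`. -/
lemma hasDerivAt_riemann_invariant {v : ℝ × ℝ → ℝ} {U : Set (ℝ × ℝ)} (hU : IsOpen U)
    (hv : ContDiffOn ℝ 2 v U) {ε c r : ℝ} (hε : ε ^ 2 = 1) (hp : (c + ε * r, r) ∈ U)
    (hw : fderiv ℝ (fderiv ℝ v) (c + ε * r, r) (0, 1) (0, 1) =
      fderiv ℝ (fderiv ℝ v) (c + ε * r, r) (1, 0) (1, 0)) :
    HasDerivAt (fun s => fderiv ℝ v (c + ε * s, s) (1, -ε)) 0 r := by
  have hsymm := (hv.contDiffAt (hU.mem_nhds hp)).isSymmSndFDerivAt (by simp)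
    |>.eq ((1, 0) : ℝ × ℝ) (0, 1)
  have hline : HasDerivAt (fun s : ℝ => (c + ε * s, s)) (ε, 1) r := by
    simpa using (((hasDerivAt_id r).const_mul ε).const_add c).prodMk (hasDerivAt_id r)
  have h := ((differentiableAt_fderiv_of_contDiffOn hU hv hp).hasFDerivAt.comp_hasDerivAt
    (f := fun s => (c + ε * s, s)) r hline).clm_apply (hasDerivAt_const r ((1, -ε) : ℝ × ℝ))
  refine h.congr_deriv ?_
  have e₁ : ((ε, 1) : ℝ × ℝ) = ε • (1, 0) + (0, 1) := by simp
  have e₂ : ((1, -ε) : ℝ × ℝ) = (1, 0) + (-ε) • (0, 1) := by simp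
  rw [e₁, e₂]
  simp only [map_add, map_smul, add_apply, smul_apply,
    smul_eq_mul, map_zero, add_zero, Function.comp]
  rw [hw, hsymm]
  linear_combination -(fderiv ℝ (fderiv ℝ v) (c + ε * r, r) (0, 1) (1, 0)) * hε

lemma riemann_invariant_eq {v : ℝ × ℝ → ℝ} {U : Set (ℝ × ℝ)} (hU : IsOpen U)
    (hv : ContDiffOn ℝ 2 v U) {ε c a b : ℝ} (hε : ε ^ 2 = 1) (hab : a ≤ b)
    (hp : ∀ r ∈ Icc a b, (c + ε * r, r) ∈ U)
    (hw : ∀ r ∈ Icc a b, fderiv ℝ (fderiv ℝ v) (c + ε * r, r) (0, 1) (0, 1) =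
      fderiv ℝ (fderiv ℝ v) (c + ε * r, r) (1, 0) (1, 0)) :
    fderiv ℝ v (c + ε * b, b) (1, -ε) = fderiv ℝ v (c + ε * a, a) (1, -ε) := by
  have hd : ∀ r ∈ Icc a b, HasDerivAt (fun s => fderiv ℝ v (c + ε * s, s) (1, -ε)) 0 r :=
    fun r hr => hasDerivAt_riemann_invariant hU hv hε (hp r hr) (hw r hr)
  exact constant_of_has_deriv_right_zero (fun r hr => (hd r hr).continuousAt.continuousWithinAt)
    (fun r hr => (hd r (Ico_subset_Icc_self hr)).hasDerivWithinAt) b (right_mem_Icc.2 hab)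

/-! ### Motion of the endpoint -/

lemma monotoneOn_add_of_speed_lt_one {ℓ ℓ' : ℝ → ℝ}
    (hℓd : ∀ t ∈ Ici (0:ℝ), HasDerivWithinAt ℓ (ℓ' t) (Ici 0) t)
    (hℓspeed : ∀ t ∈ Ici (0:ℝ), |ℓ' t| < 1) :
    MonotoneOn (fun t => t + ℓ t) (Ici 0) := by
  have hd : ∀ t ∈ Ici (0:ℝ), HasDerivWithinAt (fun t => t + ℓ t) (1 + ℓ' t) (Ici 0) t :=
    fun t ht => (hasDerivWithinAt_id t _).add (hℓd t ht)
  refine monotoneOn_of_hasDerivWithinAt_nonneg (f' := fun t => 1 + ℓ' t) (convex_Ici 0)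
    (fun t ht => (hd t ht).continuousWithinAt)
    (fun t ht => (hd t (interior_subset ht)).mono interior_subset) fun t ht => ?_
  have := (abs_lt.1 (hℓspeed t (interior_subset ht))).1
  linarith

lemma monotoneOn_sub_of_speed_lt_one {ℓ ℓ' : ℝ → ℝ}
    (hℓd : ∀ t ∈ Ici (0:ℝ), HasDerivWithinAt ℓ (ℓ' t) (Ici 0) t)
    (hℓspeed : ∀ t ∈ Ici (0:ℝ), |ℓ' t| < 1) :
    MonotoneOn (fun t => t - ℓ t) (Ici 0) := by
  have h := monotoneOn_add_of_speed_lt_one (ℓ := fun t => -ℓ t) (ℓ' := fun t => -ℓ' t)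
    (fun t ht => (hℓd t ht).neg) (fun t ht => by simpa using hℓspeed t ht)
  simpa [sub_eq_add_neg] using h

/-- Travelling wave representation on the noncylindrical domain, at the level of first derivatives. -/
lemma exists_dAlembert_profile {ℓ ℓ' : ℝ → ℝ}
    (hℓd : ∀ t ∈ Ici (0:ℝ), HasDerivWithinAt ℓ (ℓ' t) (Ici 0) t)
    (hℓspeed : ∀ t ∈ Ici (0:ℝ), |ℓ' t| < 1)
    {u : ℝ → ℝ → ℝ} {U : Set (ℝ × ℝ)} (hUopen : IsOpen U)
    (hUK : {p : ℝ × ℝ | 0 ≤ p.2 ∧ p.1 ∈ Icc 0 (ℓ p.2)} ⊆ U)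
    (hℓpos : ∀ t ∈ Ici (0:ℝ), 0 < ℓ t)
    (huC2 : ContDiffOn ℝ 2 (fun p : ℝ × ℝ => u p.1 p.2) U)
    (hwave : ∀ x t : ℝ, 0 ≤ t → x ∈ Icc 0 (ℓ t) →
      deriv (deriv (u x)) t = deriv (deriv (fun y => u y t)) x)
    (hbc0 : ∀ t : ℝ, 0 ≤ t → u 0 t = 0) :
    ∃ g : ℝ → ℝ, ContinuousOn g (Ici (-ℓ 0)) ∧ ∀ x t : ℝ, 0 ≤ t → x ∈ Icc 0 (ℓ t) →
      deriv (fun y => u y t) x = g (t + x) + g (t - x) ∧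
      deriv (u x) t = g (t + x) - g (t - x) := by
  set v : ℝ × ℝ → ℝ := fun p => u p.1 p.2
  have hdiff : ∀ p ∈ U, DifferentiableAt ℝ v p := fun p hp =>
    (huC2.differentiableOn two_ne_zero).differentiableAt (hUopen.mem_nhds hp)
  have hmem : ∀ x t : ℝ, 0 ≤ t → 0 ≤ x → x ≤ ℓ t → (x, t) ∈ U :=
    fun x t ht h0 h1 => hUK ⟨ht, h0, h1⟩
  have hw : ∀ x t : ℝ, 0 ≤ t → 0 ≤ x → x ≤ ℓ t →
      fderiv ℝ (fderiv ℝ v) (x, t) (0, 1) (0, 1) =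
        fderiv ℝ (fderiv ℝ v) (x, t) (1, 0) (1, 0) := fun x t ht h0 h1 => by
    have hp := hmem x t ht h0 h1
    rw [← deriv_deriv_left_eq_fderiv hUopen huC2 hp, ← deriv_deriv_right_eq_fderiv hUopen huC2 hp]
    exact hwave x t ht ⟨h0, h1⟩
  have hut0 : ∀ t : ℝ, 0 ≤ t → fderiv ℝ v (0, t) (0, 1) = 0 := fun t ht => by
    have hp := hdiff _ (hmem 0 t ht le_rfl (hℓpos t ht).le)
    have hd : HasDerivAt (u 0) (fderiv ℝ v (0, t) (0, 1)) t :=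
      hp.hasFDerivAt.comp_hasDerivAt (f := fun s => (0, s)) t
        ((hasDerivAt_const t 0).prodMk (hasDerivAt_id t))
    exact (uniqueDiffOn_Ici (0:ℝ) t ht).eq_deriv _ hd.hasDerivWithinAt
      ((hasDerivWithinAt_const t (Ici (0:ℝ)) (0:ℝ)).congr (fun s hs => hbc0 s hs) (hbc0 t ht))
  have hadd := monotoneOn_add_of_speed_lt_one hℓd hℓspeed
  have hsub := monotoneOn_sub_of_speed_lt_one hℓd hℓspeed
  -- the two families of characteristics
  have hleft : ∀ x t : ℝ, 0 ≤ t → 0 ≤ x → x ≤ ℓ t →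
      fderiv ℝ v (0, t + x) (1, 1) = fderiv ℝ v (x, t) (1, 1) := fun x t ht h0 h1 => by
    have hin : ∀ r ∈ Icc t (t + x), 0 ≤ r ∧ 0 ≤ (t + x) + -1 * r ∧ (t + x) + -1 * r ≤ ℓ r :=
      fun r hr => by
        have := hadd ht (ht.trans hr.1) hr.1
        dsimp only at this
        exact ⟨ht.trans hr.1, by linarith [hr.2], by linarith⟩
    have := riemann_invariant_eq hUopen huC2 (ε := -1) (c := t + x) (a := t) (b := t + x)
      (by norm_num) (by linarith) (fun r hr => hmem _ _ (hin r hr).1 (hin r hr).2.1 (hin r hr).2.2)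
      (fun r hr => hw _ _ (hin r hr).1 (hin r hr).2.1 (hin r hr).2.2)
    convert this using 3 <;> norm_num
  have hright : ∀ x t : ℝ, 0 ≤ t → 0 ≤ x → x ≤ ℓ t →
      fderiv ℝ v (max (-(t - x)) 0, max (t - x) 0) (1, -1) = fderiv ℝ v (x, t) (1, -1) :=
    fun x t ht h0 h1 => by
    have ha : 0 ≤ max (t - x) 0 := le_max_right _ _
    have hin : ∀ r ∈ Icc (max (t - x) 0) t,
        0 ≤ r ∧ 0 ≤ (x - t) + 1 * r ∧ (x - t) + 1 * r ≤ ℓ r := fun r hr => by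
      have h3 := hsub (ha.trans hr.1) ht hr.2
      have h4 := (le_max_left (t - x) 0).trans hr.1
      dsimp only at h3
      exact ⟨ha.trans hr.1, by linarith, by linarith⟩
    have := riemann_invariant_eq hUopen huC2 (ε := 1) (c := x - t) (a := max (t - x) 0) (b := t)
      (by norm_num) (max_le (by linarith) ht)
      (fun r hr => hmem _ _ (hin r hr).1 (hin r hr).2.1 (hin r hr).2.2)
      (fun r hr => hw _ _ (hin r hr).1 (hin r hr).2.1 (hin r hr).2.2)
    have hx : x - t + 1 * max (t - x) 0 = max (-(t - x)) 0 := by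
      rcases le_total (t - x) 0 with h | h
      · rw [max_eq_right h, max_eq_left (by linarith)]; ring
      · rw [max_eq_left h, max_eq_right (by linarith)]; ring
    rw [hx, one_mul, sub_add_cancel] at this
    exact this.symm
  refine ⟨fun s => fderiv ℝ v (max (-s) 0, max s 0) (1, -1) / 2, ?_, fun x t ht hx => ?_⟩
  · have hD : ContinuousOn (fderiv ℝ v) U := fun p hp =>
      (differentiableAt_fderiv_of_contDiffOn hUopen huC2 hp).continuousAt.continuousWithinAt
    have hc : ContinuousOn (fun s : ℝ => (max (-s) 0, max s 0)) (Ici (-ℓ 0)) := by fun_prop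
    refine ((hD.comp hc fun s hs => ?_).clm_apply continuousOn_const).div_const 2
    refine hmem _ _ (le_max_right _ _) (le_max_right _ _) ?_
    rcases le_total s 0 with h | h
    · rw [max_eq_right h]
      exact max_le (by linarith [mem_Ici.1 hs]) (hℓpos 0 self_mem_Ici).le
    · rw [max_eq_left h, max_eq_right (by linarith)]
      exact (hℓpos s h).le
  · have hp := hdiff _ (hmem x t ht hx.1 hx.2)
    have hs : 0 ≤ t + x := add_nonneg ht hx.1
    have h0 := hut0 (t + x) hs
    have hL := hleft x t ht hx.1 hx.2
    have hR := hright x t ht hx.1 hx.2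
    have e₁ : ((1, 1) : ℝ × ℝ) = (1, 0) + (0, 1) := by simp
    have e₂ : ((1, -1) : ℝ × ℝ) = (1, 0) - (0, 1) := by simp
    dsimp only
    rw [hR, max_eq_left hs, max_eq_right (by linarith : -(t + x) ≤ 0),
      deriv_left_eq_fderiv hp, deriv_right_eq_fderiv hp]
    simp only [e₁, e₂, map_add, map_sub] at hL ⊢
    constructor <;> linarith

/-- Differentiated Moore equation. -/
lemma deriv_moore_equation {ℓ ℓ' : ℝ → ℝ}
    (hℓd : ∀ t ∈ Ici (0:ℝ), HasDerivWithinAt ℓ (ℓ' t) (Ici 0) t)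
    (hℓspeed : ∀ t ∈ Ici (0:ℝ), |ℓ' t| < 1)
    {φ φ' : ℝ → ℝ}
    (hℓpos : ∀ t ∈ Ici (0:ℝ), 0 < ℓ t)
    (hφd : ∀ s ∈ Ici (-ℓ 0), HasDerivWithinAt φ (φ' s) (Ici (-ℓ 0)) s)
    (hMoore : ∀ t ∈ Ici (0:ℝ), φ (t + ℓ t) - φ (t - ℓ t) = 2) {t : ℝ} (ht : 0 ≤ t) :
    φ' (t + ℓ t) * (1 + ℓ' t) = φ' (t - ℓ t) * (1 - ℓ' t) := by
  have hsub : MapsTo (fun t => t - ℓ t) (Ici 0) (Ici (-ℓ 0)) := fun s hs => by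
    simpa using monotoneOn_sub_of_speed_lt_one hℓd hℓspeed self_mem_Ici hs hs
  have hadd : MapsTo (fun t => t + ℓ t) (Ici 0) (Ici (-ℓ 0)) := fun s hs => by
    have h : -ℓ 0 ≤ s - ℓ s := hsub hs
    exact h.trans (by linarith [hℓpos s hs])
  have h₁ := (hφd _ (hadd ht)).comp t ((hasDerivWithinAt_id t _).add (hℓd t ht)) hadd
  have h₂ := (hφd _ (hsub ht)).comp t ((hasDerivWithinAt_id t _).sub (hℓd t ht)) hsub
  have h₃ : HasDerivWithinAt (fun t => φ (t + ℓ t) - φ (t - ℓ t)) 0 (Ici 0) t :=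
    (hasDerivWithinAt_const t (Ici (0:ℝ)) (2:ℝ)).congr hMoore (hMoore t ht)
  have := (uniqueDiffOn_Ici (0:ℝ) t ht).eq_deriv _ (h₁.sub h₂) h₃
  linarith

/-- If the flux of `ψ` through both moving endpoints `t ± ℓ t` agrees, its integral between them
is conserved. -/
lemma integral_moving_interval_eq {ℓ ℓ' : ℝ → ℝ}
    (hℓd : ∀ t ∈ Ici (0:ℝ), HasDerivWithinAt ℓ (ℓ' t) (Ici 0) t)
    (hℓspeed : ∀ t ∈ Ici (0:ℝ), |ℓ' t| < 1)
    {ψ : ℝ → ℝ} (hψ : ContinuousOn ψ (Ici (-ℓ 0)))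
    (hℓpos : ∀ t ∈ Ici (0:ℝ), 0 < ℓ t)
    (hflux : ∀ t : ℝ, 0 < t → ψ (t + ℓ t) * (1 + ℓ' t) = ψ (t - ℓ t) * (1 - ℓ' t))
    {a b : ℝ} (ha : 0 ≤ a) (hab : a ≤ b) :
    ∫ s in (b - ℓ b)..(b + ℓ b), ψ s = ∫ s in (a - ℓ a)..(a + ℓ a), ψ s := by
  have hsub : ∀ t, 0 ≤ t → -ℓ 0 ≤ t - ℓ t := fun s hs => by
    simpa using monotoneOn_sub_of_speed_lt_one hℓd hℓspeed self_mem_Ici hs hs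
  have hadd : ∀ t, 0 ≤ t → -ℓ 0 ≤ t + ℓ t := fun s hs =>
    (hsub s hs).trans (by linarith [hℓpos s hs])
  obtain ⟨Ψ, hΨ, hΨeq⟩ : ∃ Ψ : ℝ → ℝ, Continuous Ψ ∧ EqOn Ψ ψ (Ici (-ℓ 0)) :=
    ⟨fun s => ψ (max s (-ℓ 0)), hψ.comp_continuous (by fun_prop) fun s => mem_Ici.2 (le_max_right _ _),
      fun s hs => by simp [max_eq_left (mem_Ici.1 hs)]⟩
  have hprim : ∀ s, HasDerivAt (fun s => ∫ y in (0:ℝ)..s, Ψ y) (Ψ s) s := fun s =>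
    intervalIntegral.integral_hasDerivAt_right (hΨ.intervalIntegrable _ _)
      (hΨ.stronglyMeasurableAtFilter _ _) hΨ.continuousAt
  have hint : ∀ t, 0 ≤ t → ∫ s in (t - ℓ t)..(t + ℓ t), ψ s =
      (∫ y in (0:ℝ)..(t + ℓ t), Ψ y) - ∫ y in (0:ℝ)..(t - ℓ t), Ψ y := fun t ht => by
    rw [intervalIntegral.integral_interval_sub_left (hΨ.intervalIntegrable _ _)
      (hΨ.intervalIntegrable _ _)]
    refine intervalIntegral.integral_congr fun s hs => (hΨeq ?_).symm
    rw [uIcc_of_le (by linarith [hℓpos t ht])] at hs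
    exact (hsub t ht).trans hs.1
  have hd : ∀ t, 0 ≤ t → HasDerivWithinAt
      (fun t => (∫ y in (0:ℝ)..(t + ℓ t), Ψ y) - ∫ y in (0:ℝ)..(t - ℓ t), Ψ y)
      (ψ (t + ℓ t) * (1 + ℓ' t) - ψ (t - ℓ t) * (1 - ℓ' t)) (Ici 0) t := fun t ht => by
    rw [← hΨeq (hadd t ht), ← hΨeq (hsub t ht)]
    exact ((hprim _).comp_hasDerivWithinAt t ((hasDerivWithinAt_id t _).add (hℓd t ht))).sub
      ((hprim _).comp_hasDerivWithinAt t ((hasDerivWithinAt_id t _).sub (hℓd t ht)))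
  rw [hint b (ha.trans hab), hint a ha]
  rcases hab.eq_or_lt with rfl | hlt
  · rfl
  obtain ⟨c, hc, hslope⟩ := exists_hasDerivAt_eq_slope
    (fun t => (∫ y in (0:ℝ)..(t + ℓ t), Ψ y) - ∫ y in (0:ℝ)..(t - ℓ t), Ψ y) (fun _ => 0) hlt
    (fun t ht => ((hd t (ha.trans ht.1)).mono fun s hs => ha.trans hs.1).continuousWithinAt)
    (fun t ht => by
      have ht0 : 0 < t := ha.trans_lt ht.1
      have := (hd t ht0.le).hasDerivAt (Ici_mem_nhds ht0)
      rwa [hflux t ht0, sub_self] at this)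
  rw [eq_div_iff (sub_pos.2 hlt).ne'] at hslope
  linarith

/-- When the endpoint retreats, the derivative of a Moore phase can only be monotone by being
nondecreasing. -/
lemma monotoneOn_deriv_moore_phase {ℓ ℓ' : ℝ → ℝ}
    (hℓd : ∀ t ∈ Ici (0:ℝ), HasDerivWithinAt ℓ (ℓ' t) (Ici 0) t)
    (hℓspeed : ∀ t ∈ Ici (0:ℝ), |ℓ' t| < 1)
    {φ' : ℝ → ℝ} {t₀ t₁ : ℝ}
    (hℓpos : ∀ t ∈ Ici (0:ℝ), 0 < ℓ t) (hφpos : ∀ s ∈ Ici (-ℓ 0), 0 < φ' s)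
    (hmoore : ∀ t : ℝ, 0 ≤ t → φ' (t + ℓ t) * (1 + ℓ' t) = φ' (t - ℓ t) * (1 - ℓ' t))
    (ht₀ : 0 ≤ t₀) (ht₀₁ : t₀ ≤ t₁)
    (hanti : AntitoneOn φ' (Icc (t₀ - ℓ t₀) (t₁ + ℓ t₁)))
    (hshr : ∀ t ∈ Icc t₀ t₁, -1 < ℓ' t ∧ ℓ' t ≤ 0) :
    MonotoneOn φ' (Icc (t₀ - ℓ t₀) (t₁ + ℓ t₁)) := by
  have hsub := monotoneOn_sub_of_speed_lt_one hℓd hℓspeed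
  have hadd := monotoneOn_add_of_speed_lt_one hℓd hℓspeed
  have hconst : ∀ t ∈ Icc t₀ t₁, ∀ s ∈ Icc (t - ℓ t) (t + ℓ t), φ' s = φ' t := by
    intro t ht
    have h0 : 0 ≤ t := ht₀.trans ht.1
    have hl := hℓpos t h0
    have hlo : t₀ - ℓ t₀ ≤ t - ℓ t := hsub ht₀ h0 ht.1
    have hhi : t + ℓ t ≤ t₁ + ℓ t₁ := hadd h0 (h0.trans ht.2) ht.2
    have hstart : -ℓ 0 ≤ t + ℓ t := by
      have : 0 - ℓ 0 ≤ t - ℓ t := hsub self_mem_Ici h0 h0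
      linarith
    have hends : φ' (t - ℓ t) ≤ φ' (t + ℓ t) := by
      nlinarith [hmoore t h0, (hshr t ht).1, (hshr t ht).2, hφpos _ hstart]
    have hval : ∀ s ∈ Icc (t - ℓ t) (t + ℓ t), φ' s = φ' (t - ℓ t) := fun s hs => by
      have hsJ : s ∈ Icc (t₀ - ℓ t₀) (t₁ + ℓ t₁) := ⟨hlo.trans hs.1, hs.2.trans hhi⟩
      have h1 := hanti ⟨hlo, by linarith⟩ hsJ hs.1
      have h2 := hanti hsJ ⟨by linarith, hhi⟩ hs.2
      linarith
    intro s hs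
    rw [hval s hs, hval t ⟨by linarith, by linarith⟩]
  have hd : ∀ t ∈ Icc t₀ t₁, HasDerivAt φ' 0 t := fun t ht => by
    have hl := hℓpos t (ht₀.trans ht.1)
    refine (hasDerivAt_const t (φ' t)).congr_of_eventuallyEq ?_
    filter_upwards [Icc_mem_nhds (by linarith : t - ℓ t < t) (by linarith : t < t + ℓ t)] with s hs
    exact hconst t ht s hs
  have hmid : ∀ t ∈ Icc t₀ t₁, φ' t = φ' t₀ := constant_of_has_deriv_right_zero
    (fun t ht => (hd t ht).continuousAt.continuousWithinAt)
    (fun t ht => (hd t (Ico_subset_Icc_self ht)).hasDerivWithinAt)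
  have hall : ∀ s ∈ Icc (t₀ - ℓ t₀) (t₁ + ℓ t₁), φ' s = φ' t₀ := fun s hs => by
    rcases le_total s t₀ with h | h
    · exact hconst t₀ (left_mem_Icc.2 ht₀₁) s ⟨hs.1, by linarith [hℓpos t₀ ht₀]⟩
    rcases le_total s t₁ with h' | h'
    · exact hmid s ⟨h, h'⟩
    · rw [hconst t₁ (right_mem_Icc.2 ht₀₁) s ⟨by linarith [hℓpos t₁ (ht₀.trans ht₀₁)], hs.2⟩]
      exact hmid t₁ (right_mem_Icc.2 ht₀₁)
  intro a ha b hb _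
  rw [hall a ha, hall b hb]

/-! ### Energy and weighted energy -/

lemma integral_sq_add_sq_reflect {g : ℝ → ℝ} {t l : ℝ} (hl : 0 ≤ l)
    (hg : ContinuousOn g (Icc (t - l) (t + l))) :
    (1 / 2) * ∫ x in (0:ℝ)..l, ((g (t + x) - g (t - x)) ^ 2 + (g (t + x) + g (t - x)) ^ 2) =
      ∫ s in (t - l)..(t + l), g s ^ 2 := by
  have hg2 := hg.pow 2
  have hi₁ : IntervalIntegrable (fun s => g s ^ 2) MeasureTheory.volume (t - l) t := by
    refine ContinuousOn.intervalIntegrable (hg2.mono ?_)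
    rw [uIcc_of_le (by linarith)]
    exact Icc_subset_Icc_right (by linarith)
  have hi₂ : IntervalIntegrable (fun s => g s ^ 2) MeasureTheory.volume t (t + l) := by
    refine ContinuousOn.intervalIntegrable (hg2.mono ?_)
    rw [uIcc_of_le (by linarith)]
    exact Icc_subset_Icc_left (by linarith)
  have hj₁ : IntervalIntegrable (fun x => g (t - x) ^ 2) MeasureTheory.volume 0 l := by
    simpa using (hi₁.comp_sub_left t).symm
  have hj₂ : IntervalIntegrable (fun x => g (t + x) ^ 2) MeasureTheory.volume 0 l := by
    simpa using hi₂.comp_add_left t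
  have e₁ := intervalIntegral.integral_comp_sub_left (a := 0) (b := l) (fun s => g s ^ 2) t
  have e₂ := intervalIntegral.integral_comp_add_left (a := 0) (b := l) (fun s => g s ^ 2) t
  rw [← intervalIntegral.integral_add_adjacent_intervals hi₁ hi₂,
    ← intervalIntegral.integral_const_mul]
  simp only [sub_zero, add_zero] at e₁ e₂
  rw [← e₁, ← e₂, ← intervalIntegral.integral_add hj₁ hj₂]
  congr 1
  ext x
  ring

/-- Comparison of `∫ g²` with `∫ e^{κ φ} g² / φ'` when `φ` and `φ'` are nondecreasing. -/
lemma integral_sq_weight_bounds {g φ φ' : ℝ → ℝ} {a b κ : ℝ} (hab : a ≤ b) (hκ : 0 ≤ κ)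
    (hg : ContinuousOn g (Icc a b)) (hφ : ContinuousOn φ (Icc a b))
    (hφ' : ContinuousOn φ' (Icc a b)) (hpos : ∀ s ∈ Icc a b, 0 < φ' s)
    (hmono : MonotoneOn φ (Icc a b)) (hmono' : MonotoneOn φ' (Icc a b)) :
    φ' a * Real.exp (-κ * φ b) * ∫ s in a..b, Real.exp (κ * φ s) * g s ^ 2 / φ' s ≤
        ∫ s in a..b, g s ^ 2 ∧
      ∫ s in a..b, g s ^ 2 ≤
        φ' b * Real.exp (-κ * φ a) * ∫ s in a..b, Real.exp (κ * φ s) * g s ^ 2 / φ' s := by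
  have hi : IntervalIntegrable (fun s => g s ^ 2) MeasureTheory.volume a b := by
    refine ContinuousOn.intervalIntegrable ?_
    rw [uIcc_of_le hab]
    exact hg.pow 2
  have hw : IntervalIntegrable (fun s => Real.exp (κ * φ s) * g s ^ 2 / φ' s)
      MeasureTheory.volume a b := by
    refine ContinuousOn.intervalIntegrable ?_
    rw [uIcc_of_le hab]
    exact (((continuousOn_const.mul hφ).rexp).mul (hg.pow 2)).div hφ' fun s hs => (hpos s hs).ne'
  have ha := left_mem_Icc.2 hab
  have hb := right_mem_Icc.2 hab
  have hfac : ∀ s ∈ Icc a b, g s ^ 2 =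
      φ' s * Real.exp (-κ * φ s) * (Real.exp (κ * φ s) * g s ^ 2 / φ' s) := fun s hs => by
    have h1 : Real.exp (-κ * φ s) * Real.exp (κ * φ s) = 1 := by
      rw [← Real.exp_add]; simp
    have h2 := (hpos s hs).ne'
    rw [mul_assoc, mul_div_assoc', ← mul_assoc (Real.exp _), h1, one_mul, mul_div_cancel₀ _ h2]
  have hnn : ∀ s ∈ Icc a b, 0 ≤ Real.exp (κ * φ s) * g s ^ 2 / φ' s := fun s hs => by
    have := hpos s hs
    positivity
  simp only [← intervalIntegral.integral_const_mul]
  constructor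
  · refine intervalIntegral.integral_mono_on hab (hw.const_mul _) hi fun s hs => ?_
    refine (mul_le_mul_of_nonneg_right ?_ (hnn s hs)).trans_eq (hfac s hs).symm
    refine mul_le_mul (hmono' ha hs hs.1) (Real.exp_le_exp.2 ?_) (Real.exp_pos _).le (hpos s hs).le
    nlinarith [hmono hs hb hs.2]
  · refine intervalIntegral.integral_mono_on hab hi (hw.const_mul _) fun s hs => ?_
    refine (hfac s hs).trans_le (mul_le_mul_of_nonneg_right ?_ (hnn s hs))
    refine mul_le_mul (hmono' hs hb hs.2) (Real.exp_le_exp.2 ?_) (Real.exp_pos _).le (hpos b hb).le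
    nlinarith [hmono ha hs hs.1]

lemma one_lt_abs_damping_ratio {η : ℝ} (h0 : 0 < η) (h1 : η ≠ 1) :
    1 < |(1 + η) / (1 - η)| := by
  have : 0 < |1 - η| := abs_pos.2 (sub_ne_zero.2 h1.symm)
  rw [abs_div, one_lt_div this, abs_of_pos (by linarith : 0 < 1 + η), abs_lt]
  constructor <;> linarith

/-- The damping condition and the Moore equation turn `e^{κ φ} g² / φ'` into a density with equal
fluxes through the two endpoints, where `κ = log |γ|`. -/
lemma weighted_flux_eq {gp gm pp pm Fp Fm l' η : ℝ} (hη0 : 0 < η) (hη1 : η ≠ 1)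
    (hl : |l'| < 1) (hpm : 0 < pm)
    (hbc : (1 + η * l') * (gp + gm) + (η + l') * (gp - gm) = 0)
    (hmoore : pp * (1 + l') = pm * (1 - l')) (hphase : Fp - Fm = 2) :
    Real.exp (Real.log |(1 + η) / (1 - η)| * Fp) * gp ^ 2 / pp * (1 + l') =
      Real.exp (Real.log |(1 + η) / (1 - η)| * Fm) * gm ^ 2 / pm * (1 - l') := by
  have hη : (1 - η) ≠ 0 := sub_ne_zero.2 hη1.symm
  have hγ : 0 < |(1 + η) / (1 - η)| := zero_lt_one.trans (one_lt_abs_damping_ratio hη0 hη1)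
  obtain ⟨hl1, hl2⟩ := abs_lt.1 hl
  have hexp : Real.exp (Real.log |(1 + η) / (1 - η)| * Fp) =
      Real.exp (Real.log |(1 + η) / (1 - η)| * Fm) * ((1 + η) / (1 - η)) ^ 2 := by
    rw [show Fp = Fm + 2 by linarith, mul_add, Real.exp_add, mul_comm _ (2:ℝ),
      show (2:ℝ) = ((2:ℕ):ℝ) by norm_num, Real.exp_nat_mul, Real.exp_log hγ, sq_abs]
  have hg : (1 + η) * (1 + l') * gp = -((1 - η) * (1 - l') * gm) := by linear_combination hbc
  have hl1' : 1 + l' ≠ 0 := by linarith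
  have hpp' : pp = pm * (1 - l') / (1 + l') := by rw [eq_div_iff hl1']; exact hmoore
  have hgp : (1 + η) * gp = -((1 - η) * (1 - l') * gm) / (1 + l') := by
    rw [eq_div_iff hl1']; linear_combination hg
  have hl2' : 1 - l' ≠ 0 := by linarith
  rw [hexp, mul_assoc (Real.exp _), ← mul_pow, div_mul_eq_mul_div _ (1 - η), hgp, hpp']
  field_simp

theorem damped_shrinking_energy_estimate
    (L : ℝ) (ℓ ℓ' : ℝ → ℝ)
    (hℓC1 : ContDiffOn ℝ 1 ℓ (Set.Ici 0))
    (hℓd : ∀ t ∈ Set.Ici (0:ℝ), HasDerivWithinAt ℓ (ℓ' t) (Set.Ici 0) t)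
    (hℓpos : ∀ t ∈ Set.Ici (0:ℝ), 0 < ℓ t)
    (hℓspeed : ∀ t ∈ Set.Ici (0:ℝ), |ℓ' t| < 1)
    (hL : ℓ 0 = L)
    (u : ℝ → ℝ → ℝ) (U : Set (ℝ × ℝ)) (hUopen : IsOpen U)
    (hUK : {p : ℝ × ℝ | 0 ≤ p.2 ∧ p.1 ∈ Set.Icc 0 (ℓ p.2)} ⊆ U)
    (huC2 : ContDiffOn ℝ 2 (fun p : ℝ × ℝ => u p.1 p.2) U)
    (hwave : ∀ x t : ℝ, 0 ≤ t → x ∈ Set.Icc 0 (ℓ t) →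
      deriv (deriv (u x)) t = deriv (deriv (fun y => u y t)) x)
    (hbc0 : ∀ t : ℝ, 0 ≤ t → u 0 t = 0)
    (η : ℝ) (hη0 : 0 < η) (hη1 : η ≠ 1)
    (hbcℓ : ∀ t : ℝ, 0 < t →
      (1 + η * ℓ' t) * deriv (fun y => u y t) (ℓ t)
        + (η + ℓ' t) * deriv (u (ℓ t)) t = 0)
    (φ φ' : ℝ → ℝ)
    (hφC1 : ContDiffOn ℝ 1 φ (Set.Ici (-L)))
    (hφd : ∀ s ∈ Set.Ici (-L), HasDerivWithinAt φ (φ' s) (Set.Ici (-L)) s)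
    (hφpos : ∀ s ∈ Set.Ici (-L), 0 < φ' s)
    (hMoore : ∀ t ∈ Set.Ici (0:ℝ), φ (t + ℓ t) - φ (t - ℓ t) = 2)
    (E : ℝ → ℝ)
    (hE : ∀ t : ℝ, E t = (1/2) * ∫ x in (0:ℝ)..(ℓ t),
      ((deriv (u x) t)^2 + (deriv (fun y => u y t) x)^2))
    (γ : ℝ) (hγ : γ = (1 + η) / (1 - η))
    (t₀ t₁ : ℝ) (ht₀ : 0 ≤ t₀) (ht₀₁ : t₀ ≤ t₁)
    (hmono : MonotoneOn φ' (Set.Icc (t₀ - ℓ t₀) (t₁ + ℓ t₁)) ∨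
      AntitoneOn φ' (Set.Icc (t₀ - ℓ t₀) (t₁ + ℓ t₁)))
    (hshr : ∀ t ∈ Set.Icc t₀ t₁, -1 < ℓ' t ∧ ℓ' t ≤ 0)
    : MonotoneOn φ' (Set.Icc (t₀ - ℓ t₀) (t₁ + ℓ t₁)) ∧
      ∀ t ∈ Set.Icc t₀ t₁,
        φ' (t - ℓ t) * Real.exp (-(Real.log |γ|) * φ (t + ℓ t))
          / (φ' (t₀ + ℓ t₀) * Real.exp (-(Real.log |γ|) * φ (t₀ - ℓ t₀))) * E t₀ ≤ E t ∧
        E t ≤ φ' (t + ℓ t) * Real.exp (-(Real.log |γ|) * φ (t - ℓ t))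
          / (φ' (t₀ - ℓ t₀) * Real.exp (-(Real.log |γ|) * φ (t₀ + ℓ t₀))) * E t₀ := by
  subst hL hγ
  set κ := Real.log |(1 + η) / (1 - η)|
  have hκ0 : 0 < κ := Real.log_pos (one_lt_abs_damping_ratio hη0 hη1)
  have hmoore : ∀ t : ℝ, 0 ≤ t → φ' (t + ℓ t) * (1 + ℓ' t) = φ' (t - ℓ t) * (1 - ℓ' t) :=
    fun t ht => deriv_moore_equation hℓd hℓspeed hℓpos hφd hMoore ht
  have hmono' : MonotoneOn φ' (Icc (t₀ - ℓ t₀) (t₁ + ℓ t₁)) := hmono.elim id fun h =>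
    monotoneOn_deriv_moore_phase hℓd hℓspeed hℓpos hφpos hmoore ht₀ ht₀₁ h hshr
  refine ⟨hmono', ?_⟩
  have hsub := monotoneOn_sub_of_speed_lt_one hℓd hℓspeed
  have hadd := monotoneOn_add_of_speed_lt_one hℓd hℓspeed
  have hlo : ∀ t, 0 ≤ t → -ℓ 0 ≤ t - ℓ t := fun t ht => by
    simpa using hsub self_mem_Ici ht ht
  have hIcc : ∀ t, 0 ≤ t → Icc (t - ℓ t) (t + ℓ t) ⊆ Ici (-ℓ 0) := fun t ht s hs =>
    (hlo t ht).trans hs.1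
  have hle : ∀ t, 0 ≤ t → t - ℓ t ≤ t + ℓ t := fun t ht => by linarith [hℓpos t ht]
  obtain ⟨g, hg, hgu⟩ :=
    exists_dAlembert_profile hℓd hℓspeed hUopen hUK hℓpos huC2 hwave hbc0
  have hφc : ContinuousOn φ (Ici (-ℓ 0)) := hφC1.continuousOn
  have hφ'c : ContinuousOn φ' (Ici (-ℓ 0)) :=
    (hφC1.continuousOn_derivWithin (uniqueDiffOn_Ici _) le_rfl).congr fun s hs =>
      ((hφd s hs).derivWithin (uniqueDiffOn_Ici _ s hs)).symm
  have hφmono : MonotoneOn φ (Ici (-ℓ 0)) :=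
    monotoneOn_of_hasDerivWithinAt_nonneg (convex_Ici _) hφc
      (fun s hs => (hφd s (interior_subset hs)).mono interior_subset)
      (fun s hs => (hφpos s (interior_subset hs)).le)
  have hEg : ∀ t, 0 ≤ t → E t = ∫ s in (t - ℓ t)..(t + ℓ t), g s ^ 2 := fun t ht => by
    rw [hE, ← integral_sq_add_sq_reflect (hℓpos t ht).le (hg.mono (hIcc t ht))]
    congr 1
    refine intervalIntegral.integral_congr fun x hx => ?_
    rw [uIcc_of_le (hℓpos t ht).le] at hx
    simp only [(hgu x t ht hx).1, (hgu x t ht hx).2]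
  set W : ℝ → ℝ := fun t => ∫ s in (t - ℓ t)..(t + ℓ t), Real.exp (κ * φ s) * g s ^ 2 / φ' s
  have hWconst : ∀ t ∈ Icc t₀ t₁, W t = W t₀ := fun t ht => by
    refine integral_moving_interval_eq hℓd hℓspeed
      ((((continuousOn_const.mul hφc).rexp).mul (hg.pow 2)).div hφ'c fun s hs => (hφpos s hs).ne')
      hℓpos (fun r hr => ?_) ht₀ ht.1
    have hbc := hbcℓ r hr
    have hends := hgu (ℓ r) r hr.le (right_mem_Icc.2 (hℓpos r hr.le).le)
    rw [hends.1, hends.2] at hbc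
    exact weighted_flux_eq hη0 hη1 (hℓspeed r hr.le)
      (hφpos _ (hlo r hr.le)) hbc (hmoore r hr.le) (hMoore r hr.le)
  have hbounds : ∀ t ∈ Icc t₀ t₁,
      φ' (t - ℓ t) * Real.exp (-κ * φ (t + ℓ t)) * W t ≤ E t ∧
        E t ≤ φ' (t + ℓ t) * Real.exp (-κ * φ (t - ℓ t)) * W t := fun t ht => by
    have h0 : 0 ≤ t := ht₀.trans ht.1
    rw [hEg t h0]
    exact integral_sq_weight_bounds (hle t h0) hκ0.le (hg.mono (hIcc t h0)) (hφc.mono (hIcc t h0))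
      (hφ'c.mono (hIcc t h0)) (fun s hs => hφpos s (hIcc t h0 hs)) (hφmono.mono (hIcc t h0))
      (hmono'.mono (Icc_subset_Icc (hsub ht₀ h0 ht.1) (hadd h0 (h0.trans ht.2) ht.2)))
  intro t ht
  have h0 : 0 ≤ t := ht₀.trans ht.1
  have hm : ∀ t, 0 ≤ t → 0 < φ' (t - ℓ t) := fun t ht => hφpos _ (hlo t ht)
  have hp : ∀ t, 0 ≤ t → 0 < φ' (t + ℓ t) := fun t ht => hφpos _ ((hlo t ht).trans (hle t ht))
  obtain ⟨hlow₀, hupp₀⟩ := hbounds t₀ (left_mem_Icc.2 ht₀₁)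
  obtain ⟨hlow, hupp⟩ := hbounds t ht
  rw [hWconst t ht] at hlow hupp
  constructor
  · refine le_trans ?_ hlow
    rw [div_mul_eq_mul_div, mul_div_assoc]
    refine mul_le_mul_of_nonneg_left ?_ (mul_pos (hm t h0) (Real.exp_pos _)).le
    exact (div_le_iff₀' (mul_pos (hp t₀ ht₀) (Real.exp_pos _))).2 hupp₀
  · refine hupp.trans ?_
    rw [div_mul_eq_mul_div, mul_div_assoc]
    refine mul_le_mul_of_nonneg_left ?_ (mul_pos (hp t h0) (Real.exp_pos _)).le
    exact (le_div_iff₀' (mul_pos (hm t₀ ht₀) (Real.exp_pos _))).2 hlow₀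
end

section
/- In the damped case (η > 0, η ≠ 1, boundary condition (1 + η ℓ′(t)) u_x(ℓ(t),t) + (η + ℓ′(t)) u_t(ℓ(t),t) = 0), suppose φ′ is monotone on [t₀ − ℓ(t₀), t₁ + ℓ(t₁)] and 0 < ℓ′(t) < 1 for all t ∈ [t₀,t₁]. Then φ′ is nonincreasing there, the energy E(t) is nonincreasing on [t₀,t₁], and for all t ∈ [t₀,t₁]: (φ′(t + ℓ(t)) e^{−ln|γ_η| φ(t + ℓ(t))})/(φ′(t₀ − ℓ(t₀)) e^{−ln|γ_η| φ(t₀ − ℓ(t₀))}) · E(t₀) ≤ E(t) ≤ (φ′(t − ℓ(t)) e^{−ln|γ_η| φ(t − ℓ(t))})/(φ′(t₀ + ℓ(t₀)) e^{−ln|γ_η| φ(t₀ + ℓ(t₀))}) · E(t₀). -/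
open Set Filter Topology

section PartialDerivatives

variable {u : ℝ → ℝ → ℝ} {x t : ℝ}

theorem hasDerivAt_snd_of_differentiableAt
    (h : DifferentiableAt ℝ (fun p : ℝ × ℝ => u p.1 p.2) (x, t)) :
    HasDerivAt (u x) (fderiv ℝ (fun p : ℝ × ℝ => u p.1 p.2) (x, t) (0, 1)) t :=
  h.hasFDerivAt.comp_hasDerivAt (f := fun s => (x, s)) t
    ((hasDerivAt_const t x).prodMk (hasDerivAt_id t))

theorem hasDerivAt_fst_of_differentiableAt
    (h : DifferentiableAt ℝ (fun p : ℝ × ℝ => u p.1 p.2) (x, t)) :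
    HasDerivAt (fun y => u y t) (fderiv ℝ (fun p : ℝ × ℝ => u p.1 p.2) (x, t) (1, 0)) x :=
  h.hasFDerivAt.comp_hasDerivAt (f := fun y => (y, t)) x
    ((hasDerivAt_id x).prodMk (hasDerivAt_const x t))

theorem differentiableAt_fderiv_of_contDiffAt_two {f : ℝ × ℝ → ℝ} {p : ℝ × ℝ}
    (h : ContDiffAt ℝ 2 f p) : DifferentiableAt ℝ (fderiv ℝ f) p :=
  (h.fderiv_right (m := 1) (by norm_num)).differentiableAt (by norm_num)

theorem eventually_differentiableAt_of_contDiffAt_two {f : ℝ × ℝ → ℝ} {p : ℝ × ℝ}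
    (h : ContDiffAt ℝ 2 f p) : ∀ᶠ q in 𝓝 p, DifferentiableAt ℝ f q :=
  (h.eventually (by simp)).mono fun _ hq => hq.differentiableAt (by norm_num)

theorem deriv_deriv_snd_of_contDiffAt
    (h : ContDiffAt ℝ 2 (fun p : ℝ × ℝ => u p.1 p.2) (x, t)) :
    deriv (deriv (u x)) t =
      fderiv ℝ (fderiv ℝ (fun p : ℝ × ℝ => u p.1 p.2)) (x, t) (0, 1) (0, 1) := by
  have hc : Tendsto (fun s => (x, s)) (𝓝 t) (𝓝 (x, t)) :=
    (Continuous.prodMk_right x).tendsto t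
  have heq : deriv (u x) =ᶠ[𝓝 t]
      fun s => fderiv ℝ (fun p : ℝ × ℝ => u p.1 p.2) (x, s) (0, 1) :=
    (hc.eventually (eventually_differentiableAt_of_contDiffAt_two h)).mono
      fun s hs => (hasDerivAt_snd_of_differentiableAt hs).deriv
  rw [heq.deriv_eq]
  have hD := (differentiableAt_fderiv_of_contDiffAt_two h).hasFDerivAt.comp_hasDerivAt
    (f := fun s => (x, s)) t ((hasDerivAt_const t x).prodMk (hasDerivAt_id t))
  simpa using (hD.clm_apply (hasDerivAt_const t ((0 : ℝ), (1 : ℝ)))).deriv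

theorem deriv_deriv_fst_of_contDiffAt
    (h : ContDiffAt ℝ 2 (fun p : ℝ × ℝ => u p.1 p.2) (x, t)) :
    deriv (deriv (fun y => u y t)) x =
      fderiv ℝ (fderiv ℝ (fun p : ℝ × ℝ => u p.1 p.2)) (x, t) (1, 0) (1, 0) := by
  have hc : Tendsto (fun y => (y, t)) (𝓝 x) (𝓝 (x, t)) :=
    (Continuous.prodMk_left t).tendsto x
  have heq : deriv (fun y => u y t) =ᶠ[𝓝 x]
      fun y => fderiv ℝ (fun p : ℝ × ℝ => u p.1 p.2) (y, t) (1, 0) :=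
    (hc.eventually (eventually_differentiableAt_of_contDiffAt_two h)).mono
      fun s hs => (hasDerivAt_fst_of_differentiableAt hs).deriv
  rw [heq.deriv_eq]
  have hD := (differentiableAt_fderiv_of_contDiffAt_two h).hasFDerivAt.comp_hasDerivAt
    (f := fun y => (y, t)) x ((hasDerivAt_id x).prodMk (hasDerivAt_const x t))
  simpa using (hD.clm_apply (hasDerivAt_const x ((1 : ℝ), (0 : ℝ)))).deriv

end PartialDerivatives

/-- For a function with equal pure second derivatives, the derivative in direction `(1, σ)`,
`σ = ±1`, is constant along segments of direction `(-1, σ)`. -/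
theorem fderiv_apply_eq_of_wave_on_segment {f : ℝ × ℝ → ℝ} {σ x t a : ℝ} (hσ : σ * σ = 1)
    (ha : 0 ≤ a) (hf : ∀ r ∈ Icc 0 a, ContDiffAt ℝ 2 f (x - r, t + σ * r))
    (hw : ∀ r ∈ Icc 0 a, fderiv ℝ (fderiv ℝ f) (x - r, t + σ * r) (0, 1) (0, 1) =
      fderiv ℝ (fderiv ℝ f) (x - r, t + σ * r) (1, 0) (1, 0)) :
    fderiv ℝ f (x - a, t + σ * a) (1, σ) = fderiv ℝ f (x, t) (1, σ) := by
  have hd : ∀ r ∈ Icc 0 a,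
      HasDerivAt (fun r => fderiv ℝ f (x - r, t + σ * r) (1, σ)) 0 r := by
    intro r hr
    have hline : HasDerivAt (fun r : ℝ => (x - r, t + σ * r)) (-1, σ) r := by
      have h1 : HasDerivAt (fun r : ℝ => x - r) (-1) r := by
        simpa using (hasDerivAt_id r).const_sub x
      have h2 : HasDerivAt (fun r : ℝ => t + σ * r) σ r := by
        simpa using ((hasDerivAt_id r).const_mul σ).const_add t
      exact h1.prodMk h2
    have hD := (differentiableAt_fderiv_of_contDiffAt_two (hf r hr)).hasFDerivAt.comp_hasDerivAt
      (f := fun r : ℝ => (x - r, t + σ * r)) r hline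
    have hD' := hD.clm_apply (hasDerivAt_const r ((1 : ℝ), σ))
    have hsymm := ((hf r hr).isSymmSndFDerivAt (by simp)).eq (1, 0) (0, 1)
    have hwr := hw r hr
    refine hD'.congr_deriv ?_
    set B := fderiv ℝ (fderiv ℝ f) (x - r, t + σ * r)
    have e1 : ((-1 : ℝ), σ) = -((1 : ℝ), (0 : ℝ)) + σ • ((0 : ℝ), (1 : ℝ)) := by simp
    have e2 : ((1 : ℝ), σ) = ((1 : ℝ), (0 : ℝ)) + σ • ((0 : ℝ), (1 : ℝ)) := by simp
    rw [e1, e2]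
    simp only [map_add, map_neg, map_smul, _root_.add_apply, map_zero, add_zero,
      _root_.neg_apply, _root_.smul_apply, smul_eq_mul]
    rw [hsymm, hwr]
    linear_combination B (1, 0) (1, 0) * hσ
  have := constant_of_has_deriv_right_zero
    (fun r hr => (hd r hr).continuousAt.continuousWithinAt)
    (fun r hr => (hd r (Ico_subset_Icc_self hr)).hasDerivWithinAt) a (right_mem_Icc.2 ha)
  simpa using this

/-- d'Alembert representation of the first derivatives of a solution of the wave equation
vanishing at `x = 0`, over a domain whose right boundary moves at most at unit speed. -/
theorem exists_dalembert_profile {ℓ : ℝ → ℝ}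
    (hadd : MonotoneOn (fun t => t + ℓ t) (Ici 0)) (hsub : MonotoneOn (fun t => t - ℓ t) (Ici 0))
    {u : ℝ → ℝ → ℝ} {U : Set (ℝ × ℝ)} (hUopen : IsOpen U)
    (hUK : {p : ℝ × ℝ | 0 ≤ p.2 ∧ p.1 ∈ Icc 0 (ℓ p.2)} ⊆ U)
    (huC2 : ContDiffOn ℝ 2 (fun p : ℝ × ℝ => u p.1 p.2) U)
    (hℓnn : ∀ t, 0 ≤ t → 0 ≤ ℓ t)
    (hwave : ∀ x t : ℝ, 0 ≤ t → x ∈ Icc 0 (ℓ t) →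
      deriv (deriv (u x)) t = deriv (deriv (fun y => u y t)) x)
    (hbc0 : ∀ t : ℝ, 0 ≤ t → u 0 t = 0) :
    ∃ F : ℝ → ℝ, Continuous F ∧ ∀ x t : ℝ, 0 ≤ t → x ∈ Icc 0 (ℓ t) →
      deriv (u x) t = F (t + x) - F (t - x) ∧
      deriv (fun y => u y t) x = F (t + x) + F (t - x) := by
  set f : ℝ × ℝ → ℝ := fun p => u p.1 p.2
  have hC2 : ∀ x t : ℝ, 0 ≤ t → x ∈ Icc 0 (ℓ t) → ContDiffAt ℝ 2 f (x, t) := fun x t ht hx =>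
    huC2.contDiffAt (hUopen.mem_nhds (hUK ⟨ht, hx⟩))
  have hw : ∀ x t : ℝ, 0 ≤ t → x ∈ Icc 0 (ℓ t) →
      fderiv ℝ (fderiv ℝ f) (x, t) (0, 1) (0, 1) =
        fderiv ℝ (fderiv ℝ f) (x, t) (1, 0) (1, 0) := fun x t ht hx => by
    rw [← deriv_deriv_snd_of_contDiffAt (hC2 x t ht hx),
      ← deriv_deriv_fst_of_contDiffAt (hC2 x t ht hx), hwave x t ht hx]
  have hseg : ∀ σ x t a : ℝ, σ * σ = 1 → 0 ≤ a →
      (∀ r ∈ Icc 0 a, 0 ≤ t + σ * r ∧ x - r ∈ Icc 0 (ℓ (t + σ * r))) →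
      fderiv ℝ f (x - a, t + σ * a) (1, σ) = fderiv ℝ f (x, t) (1, σ) := by
    intro σ x t a hσ ha h
    exact fderiv_apply_eq_of_wave_on_segment hσ ha
      (fun r hr => hC2 _ _ (h r hr).1 (h r hr).2) (fun r hr => hw _ _ (h r hr).1 (h r hr).2)
  have hut0 : ∀ t, 0 ≤ t → fderiv ℝ f (0, t) (0, 1) = 0 := by
    intro t ht
    have h1 := (hasDerivAt_snd_of_differentiableAt
      ((hC2 0 t ht ⟨le_rfl, hℓnn t ht⟩).differentiableAt (by norm_num))).hasDerivWithinAt (s := Ici t)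
    have h2 : HasDerivWithinAt (u 0) 0 (Ici t) t :=
      (hasDerivWithinAt_const t (Ici t) (0 : ℝ)).congr
        (fun s hs => hbc0 s (ht.trans hs)) (hbc0 t ht)
    exact (uniqueDiffOn_Ici t t self_mem_Ici).eq_deriv _ h1 h2
  have e2 : ∀ σ : ℝ, ((1 : ℝ), σ) = ((1 : ℝ), (0 : ℝ)) + σ • ((0 : ℝ), (1 : ℝ)) := by simp
  let c : ℝ → ℝ × ℝ := fun s => (max (-(max s (-ℓ 0))) 0, max s 0)
  have hc : Continuous c := by fun_prop
  have hcU : ∀ s, c s ∈ U := by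
    intro s
    refine hUK ⟨le_max_right _ _, le_max_right _ _, ?_⟩
    rcases le_total 0 s with hs | hs
    · have : max (-(max s (-ℓ 0))) 0 = 0 :=
        max_eq_right (neg_nonpos.2 (hs.trans (le_max_left _ _)))
      simpa [c, this] using hℓnn _ (le_max_right s 0)
    · have h1 : max s 0 = 0 := max_eq_right hs
      simp only [c, h1]
      exact max_le (neg_le.1 (le_max_right _ _)) (hℓnn 0 le_rfl)
  have hDcont : ContinuousOn (fderiv ℝ f) U := huC2.continuousOn_fderiv_of_isOpen hUopen (by norm_num)
  refine ⟨fun s => fderiv ℝ f (c s) (1, -1) / 2, ?_, ?_⟩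
  · exact ((hDcont.comp_continuous hc hcU).clm_apply continuous_const).div_const 2
  intro x t ht hx
  have hdiff := (hC2 x t ht hx).differentiableAt (by norm_num)
  rw [(hasDerivAt_snd_of_differentiableAt hdiff).deriv,
    (hasDerivAt_fst_of_differentiableAt hdiff).deriv]
  have hplus : fderiv ℝ f (x, t) (1, 1) = fderiv ℝ f (c (t + x)) (1, -1) := by
    have hcx : c (t + x) = (0, t + x) := by
      have h0 : 0 ≤ t + x := add_nonneg ht hx.1
      simp [c, h0]
    have := hseg 1 x t x (by norm_num) hx.1 fun r hr => by
      have h1 : 0 ≤ t + 1 * r := by linarith [hr.1]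
      refine ⟨h1, by linarith [hr.2], ?_⟩
      have := hadd ht h1 (by linarith [hr.1])
      simp only at this
      linarith [hx.2]
    rw [← this, hcx, sub_self, one_mul, e2 1, e2 (-1)]
    simp only [map_add, map_smul, hut0 (t + x) (add_nonneg ht hx.1), smul_zero]
  have hminus : fderiv ℝ f (x, t) (1, -1) = fderiv ℝ f (c (t - x)) (1, -1) := by
    have hback : ∀ a, 0 ≤ a → a ≤ x → a ≤ t →
        fderiv ℝ f (x - a, t + -1 * a) (1, -1) = fderiv ℝ f (x, t) (1, -1) := fun a ha hax hat =>
      hseg (-1) x t a (by norm_num) ha fun r hr => by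
        have h1 : 0 ≤ t + -1 * r := by linarith [hr.2]
        refine ⟨h1, by linarith [hr.2], ?_⟩
        have := hsub h1 ht (by linarith [hr.1])
        simp only at this
        linarith [hx.2]
    rcases le_total x t with hxt | hxt
    · have hcx : c (t - x) = (x - x, t + -1 * x) := by
        have h0 : 0 ≤ t - x := sub_nonneg.2 hxt
        have : max (-(max (t - x) (-ℓ 0))) 0 = 0 :=
          max_eq_right (neg_nonpos.2 (h0.trans (le_max_left _ _)))
        simp only [c, this, max_eq_left h0, Prod.mk.injEq]
        constructor <;> ring
      rw [hcx, hback x hx.1 le_rfl hxt]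
    · have hcx : c (t - x) = (x - t, t + -1 * t) := by
        have h0 : t - x ≤ 0 := sub_nonpos.2 hxt
        have h1 : -ℓ 0 ≤ t - x := by
          have := hsub self_mem_Ici ht ht
          simp only at this
          linarith [hx.2]
        simp only [c, max_eq_left h1, max_eq_right h0, Prod.mk.injEq]
        rw [max_eq_left (by linarith)]
        constructor <;> ring
      rw [hcx, hback t ht hxt le_rfl]
  simp only [← hplus, ← hminus]
  rw [e2 1, e2 (-1)]
  simp only [map_add, map_smul, smul_eq_mul]
  constructor <;> ring

theorem hasDerivWithinAt_integral_sub_add {k ℓ : ℝ → ℝ} (hk : Continuous k) {m t : ℝ} {s : Set ℝ}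
    (hℓ : HasDerivWithinAt ℓ m s t) :
    HasDerivWithinAt (fun t => ∫ x in (t - ℓ t)..(t + ℓ t), k x)
      (k (t + ℓ t) * (1 + m) - k (t - ℓ t) * (1 - m)) s t := by
  have hprim : ∀ b, HasDerivAt (fun b => ∫ x in (0 : ℝ)..b, k x) (k b) b := fun b =>
    (hk.integral_hasStrictDerivAt 0 b).hasDerivAt
  have h1 := (hprim (t + ℓ t)).comp_hasDerivWithinAt t ((hasDerivWithinAt_id t s).add hℓ)
  have h2 := (hprim (t - ℓ t)).comp_hasDerivWithinAt t ((hasDerivWithinAt_id t s).sub hℓ)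
  refine (h1.sub h2).congr_of_eventuallyEq (Eventually.of_forall fun r => ?_) ?_ <;>
  exact (intervalIntegral.integral_interval_sub_left (hk.intervalIntegrable _ _)
      (hk.intervalIntegrable _ _)).symm

theorem integral_zero_add_sub_comp {k : ℝ → ℝ} (hk : Continuous k) (t a : ℝ) :
    ∫ x in (0 : ℝ)..a, (k (t + x) + k (t - x)) = ∫ x in (t - a)..(t + a), k x := by
  have h1 : Continuous fun x => k (t + x) := by fun_prop
  have h2 : Continuous fun x => k (t - x) := by fun_prop
  rw [intervalIntegral.integral_add (h1.intervalIntegrable _ _) (h2.intervalIntegrable _ _),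
    intervalIntegral.integral_comp_add_left, intervalIntegral.integral_comp_sub_left,
    add_zero, sub_zero, add_comm]
  exact intervalIntegral.integral_add_adjacent_intervals (hk.intervalIntegrable _ _)
    (hk.intervalIntegrable _ _)

theorem flux_balance_of_reflection {η m a b p q e d : ℝ} (hη0 : 0 < η) (hm : 0 < 1 + m)
    (hp : 0 < p) (hq : 0 < q) (he : 0 < e) (hd : 0 < d)
    (hrefl : a * (1 + η) * (1 + m) + b * (1 - η) * (1 - m) = 0)
    (hpq : p * (1 + m) = q * (1 - m)) (hed : (1 + η) ^ 2 * e = (1 - η) ^ 2 * d) :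
    a ^ 2 / (p * e) * (1 + m) = b ^ 2 / (q * d) * (1 - m) := by
  rw [div_mul_eq_mul_div, div_mul_eq_mul_div, div_eq_div_iff (by positivity) (by positivity)]
  have hA : (1 + η) ^ 2 * (1 + m) ≠ 0 := by positivity
  refine mul_left_cancel₀ hA ?_
  linear_combination
    q * d * (a * (1 + η) * (1 + m) - b * (1 - η) * (1 - m)) * hrefl
      - b ^ 2 * (1 - m) * (1 + η) ^ 2 * e * hpq - b ^ 2 * (1 - m) ^ 2 * q * hed

theorem flux_le_of_reflection {η m a b : ℝ} (hη0 : 0 < η) (hm0 : 0 ≤ m) (hm1 : m < 1)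
    (hrefl : a * (1 + η) * (1 + m) + b * (1 - η) * (1 - m) = 0) :
    a ^ 2 * (1 + m) ≤ b ^ 2 * (1 - m) := by
  have hA : 0 < (1 + η) ^ 2 * (1 + m) := by positivity
  refine le_of_mul_le_mul_left ?_ hA
  have h1 : (1 + η) ^ 2 * (1 + m) * (a ^ 2 * (1 + m)) = b ^ 2 * (1 - m) * ((1 - η) ^ 2 * (1 - m)) := by
    linear_combination (a * (1 + η) * (1 + m) - b * (1 - η) * (1 - m)) * hrefl
  have h2 : (1 - η) ^ 2 * (1 - m) ≤ (1 + η) ^ 2 * (1 + m) := by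
    apply mul_le_mul <;> nlinarith
  have h3 : 0 ≤ b ^ 2 * (1 - m) := mul_nonneg (sq_nonneg _) (by linarith)
  nlinarith [mul_le_mul_of_nonneg_left h2 h3]

theorem one_lt_abs_add_div_sub {η : ℝ} (hη0 : 0 < η) (hη1 : η ≠ 1) :
    1 < |(1 + η) / (1 - η)| := by
  have h : 0 < |1 - η| := abs_pos.2 (sub_ne_zero.2 hη1.symm)
  rw [abs_div, lt_div_iff₀ h, one_mul, abs_of_pos (by linarith : 0 < 1 + η), abs_lt]
  constructor <;> linarith

theorem sq_mul_exp_neg_log_abs_add_two {η : ℝ} (hη0 : 0 < η) (hη1 : η ≠ 1) {x y : ℝ}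
    (h : x - y = 2) :
    (1 + η) ^ 2 * Real.exp (-(Real.log |(1 + η) / (1 - η)|) * x) =
      (1 - η) ^ 2 * Real.exp (-(Real.log |(1 + η) / (1 - η)|) * y) := by
  have hγ := zero_lt_one.trans (one_lt_abs_add_div_sub hη0 hη1)
  have h1 : 1 - η ≠ 0 := sub_ne_zero.2 hη1.symm
  have h2 : 1 + η ≠ 0 := by positivity
  set c := Real.log |(1 + η) / (1 - η)| with hc
  have e : -c * y = -c * x + (c + c) := by linear_combination c * h
  rw [e, Real.exp_add, Real.exp_add, hc, Real.exp_log hγ, abs_mul_abs_self]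
  field_simp

/-- An integral against an antitone weight lies between the extreme values of the weight
times the unweighted integral. -/
theorem integral_antitoneOn_mul_bounds {f k w : ℝ → ℝ} {a b : ℝ} (hab : a ≤ b)
    (hf : Continuous f) (hk : Continuous k) (hw : AntitoneOn w (Icc a b))
    (hk0 : ∀ s ∈ Icc a b, 0 ≤ k s) (hfk : ∀ s ∈ Icc a b, f s = w s * k s) :
    w b * ∫ s in a..b, k s ≤ ∫ s in a..b, f s ∧
      ∫ s in a..b, f s ≤ w a * ∫ s in a..b, k s := by
  have ha := left_mem_Icc.2 hab
  have hb := right_mem_Icc.2 hab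
  rw [← intervalIntegral.integral_const_mul, ← intervalIntegral.integral_const_mul]
  constructor <;>
  refine intervalIntegral.integral_mono_on hab (Continuous.intervalIntegrable (by fun_prop) _ _)
    (Continuous.intervalIntegrable (by fun_prop) _ _) fun s hs => ?_
  · rw [hfk s hs]
    exact mul_le_mul_of_nonneg_right (hw hs hb hs.2) (hk0 s hs)
  · rw [hfk s hs]
    exact mul_le_mul_of_nonneg_right (hw ha hs hs.1) (hk0 s hs)

theorem damped_expanding_energy_estimate
    (L : ℝ) (ℓ ℓ' : ℝ → ℝ)
    (hℓC1 : ContDiffOn ℝ 1 ℓ (Set.Ici 0))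
    (hℓd : ∀ t ∈ Set.Ici (0:ℝ), HasDerivWithinAt ℓ (ℓ' t) (Set.Ici 0) t)
    (hℓpos : ∀ t ∈ Set.Ici (0:ℝ), 0 < ℓ t)
    (hℓspeed : ∀ t ∈ Set.Ici (0:ℝ), |ℓ' t| < 1)
    (hL : ℓ 0 = L)
    (u : ℝ → ℝ → ℝ) (U : Set (ℝ × ℝ)) (hUopen : IsOpen U)
    (hUK : {p : ℝ × ℝ | 0 ≤ p.2 ∧ p.1 ∈ Set.Icc 0 (ℓ p.2)} ⊆ U)
    (huC2 : ContDiffOn ℝ 2 (fun p : ℝ × ℝ => u p.1 p.2) U)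
    (hwave : ∀ x t : ℝ, 0 ≤ t → x ∈ Set.Icc 0 (ℓ t) →
      deriv (deriv (u x)) t = deriv (deriv (fun y => u y t)) x)
    (hbc0 : ∀ t : ℝ, 0 ≤ t → u 0 t = 0)
    (η : ℝ) (hη0 : 0 < η) (hη1 : η ≠ 1)
    (hbcℓ : ∀ t : ℝ, 0 < t →
      (1 + η * ℓ' t) * deriv (fun y => u y t) (ℓ t)
        + (η + ℓ' t) * deriv (u (ℓ t)) t = 0)
    (φ φ' : ℝ → ℝ)
    (hφC1 : ContDiffOn ℝ 1 φ (Set.Ici (-L)))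
    (hφd : ∀ s ∈ Set.Ici (-L), HasDerivWithinAt φ (φ' s) (Set.Ici (-L)) s)
    (hφpos : ∀ s ∈ Set.Ici (-L), 0 < φ' s)
    (hMoore : ∀ t ∈ Set.Ici (0:ℝ), φ (t + ℓ t) - φ (t - ℓ t) = 2)
    (E : ℝ → ℝ)
    (hE : ∀ t : ℝ, E t = (1/2) * ∫ x in (0:ℝ)..(ℓ t),
      ((deriv (u x) t)^2 + (deriv (fun y => u y t) x)^2))
    (γ : ℝ) (hγ : γ = (1 + η) / (1 - η))
    (t₀ t₁ : ℝ) (ht₀ : 0 ≤ t₀) (ht₀₁ : t₀ ≤ t₁)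
    (hmono : MonotoneOn φ' (Set.Icc (t₀ - ℓ t₀) (t₁ + ℓ t₁)) ∨
      AntitoneOn φ' (Set.Icc (t₀ - ℓ t₀) (t₁ + ℓ t₁)))
    (hexp : ∀ t ∈ Set.Icc t₀ t₁, 0 < ℓ' t ∧ ℓ' t < 1)
    : AntitoneOn φ' (Set.Icc (t₀ - ℓ t₀) (t₁ + ℓ t₁)) ∧
      AntitoneOn E (Set.Icc t₀ t₁) ∧
      ∀ t ∈ Set.Icc t₀ t₁,
        φ' (t + ℓ t) * Real.exp (-(Real.log |γ|) * φ (t + ℓ t))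
          / (φ' (t₀ - ℓ t₀) * Real.exp (-(Real.log |γ|) * φ (t₀ - ℓ t₀))) * E t₀ ≤ E t ∧
        E t ≤ φ' (t - ℓ t) * Real.exp (-(Real.log |γ|) * φ (t - ℓ t))
          / (φ' (t₀ + ℓ t₀) * Real.exp (-(Real.log |γ|) * φ (t₀ + ℓ t₀))) * E t₀ := by
  have hγ1 : 1 < |γ| := hγ ▸ one_lt_abs_add_div_sub hη0 hη1
  have hm : ∀ t, 0 ≤ t → 0 < 1 + ℓ' t ∧ 0 < 1 - ℓ' t := fun t ht => by
    have := abs_lt.1 (hℓspeed t ht)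
    constructor <;> linarith [this.1, this.2]
  have hdadd : ∀ t ∈ Ici (0 : ℝ), HasDerivWithinAt (fun t => t + ℓ t) (1 + ℓ' t) (Ici 0) t :=
    fun t ht => (hasDerivWithinAt_id t _).add (hℓd t ht)
  have hdsub : ∀ t ∈ Ici (0 : ℝ), HasDerivWithinAt (fun t => t - ℓ t) (1 - ℓ' t) (Ici 0) t :=
    fun t ht => (hasDerivWithinAt_id t _).sub (hℓd t ht)
  have hadd : StrictMonoOn (fun t => t + ℓ t) (Ici 0) :=
    strictMonoOn_of_hasDerivWithinAt_pos (convex_Ici 0)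
      (fun t ht => (hdadd t ht).continuousWithinAt)
      (fun t ht => (hdadd t (interior_subset ht)).mono interior_subset)
      (fun t ht => (hm t (interior_subset ht)).1)
  have hsub : StrictMonoOn (fun t => t - ℓ t) (Ici 0) :=
    strictMonoOn_of_hasDerivWithinAt_pos (convex_Ici 0)
      (fun t ht => (hdsub t ht).continuousWithinAt)
      (fun t ht => (hdsub t (interior_subset ht)).mono interior_subset)
      (fun t ht => (hm t (interior_subset ht)).2)
  have hminus : ∀ t, 0 ≤ t → -L ≤ t - ℓ t := fun t ht => by
    have := hsub.monotoneOn self_mem_Ici ht ht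
    simpa [hL] using this
  have hplus : ∀ t, 0 ≤ t → -L ≤ t + ℓ t := fun t ht => by
    linarith [hminus t ht, hℓpos t ht]
  have hφ'rel : ∀ t, 0 ≤ t → φ' (t + ℓ t) * (1 + ℓ' t) = φ' (t - ℓ t) * (1 - ℓ' t) := by
    intro t ht
    have h1 := (hφd _ (hplus t ht)).comp t (hdadd t ht) fun s hs => hplus s hs
    have h2 := (hφd _ (hminus t ht)).comp t (hdsub t ht) fun s hs => hminus s hs
    have h3 : HasDerivWithinAt ((φ ∘ fun t => t + ℓ t) - (φ ∘ fun t => t - ℓ t)) 0 (Ici 0) t :=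
      (hasDerivWithinAt_const t (Ici 0) (2 : ℝ)).congr (fun s hs => hMoore s hs) (hMoore t ht)
    linarith [(uniqueDiffOn_Ici (0 : ℝ) t ht).eq_deriv _ (h1.sub h2) h3]
  have hIcc : ∀ t ∈ Icc t₀ t₁, 0 ≤ t ∧ t₀ - ℓ t₀ ≤ t - ℓ t ∧ t - ℓ t ≤ t + ℓ t ∧
      t + ℓ t ≤ t₁ + ℓ t₁ := fun t ht => by
    have h0 : 0 ≤ t := ht₀.trans ht.1
    exact ⟨h0, hsub.monotoneOn ht₀ h0 ht.1, by linarith [hℓpos t h0],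
      hadd.monotoneOn h0 (ht₀.trans ht₀₁) ht.2⟩
  have hanti : AntitoneOn φ' (Icc (t₀ - ℓ t₀) (t₁ + ℓ t₁)) := by
    refine hmono.resolve_left fun hmon => ?_
    have ht : t₀ ∈ Icc t₀ t₁ := left_mem_Icc.2 ht₀₁
    obtain ⟨-, h1, h2, h3⟩ := hIcc t₀ ht
    have h4 := hmon ⟨h1, h2.trans h3⟩ ⟨h1.trans h2, h3⟩ h2
    have h5 := hφ'rel t₀ ht₀
    have h6 := hφpos _ (hplus t₀ ht₀)
    have h7 := hφpos _ (hminus t₀ ht₀)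
    nlinarith [(hexp t₀ ht).1]
  obtain ⟨F, hF, hdal⟩ := exists_dalembert_profile hadd.monotoneOn hsub.monotoneOn
    hUopen hUK huC2 (fun t ht => (hℓpos t ht).le) hwave hbc0
  have hF2 : Continuous fun s => F s ^ 2 := hF.pow 2
  have hEF : ∀ t, 0 ≤ t → E t = ∫ s in (t - ℓ t)..(t + ℓ t), F s ^ 2 := by
    intro t ht
    rw [hE, ← integral_zero_add_sub_comp hF2, ← intervalIntegral.integral_const_mul]
    refine intervalIntegral.integral_congr fun x hx => ?_
    rw [uIcc_of_le (hℓpos t ht).le] at hx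
    obtain ⟨h1, h2⟩ := hdal x t ht hx
    simp only [h1, h2]
    ring
  have hrefl : ∀ t, 0 < t → F (t + ℓ t) * (1 + η) * (1 + ℓ' t)
      + F (t - ℓ t) * (1 - η) * (1 - ℓ' t) = 0 := by
    intro t ht
    obtain ⟨h1, h2⟩ := hdal (ℓ t) t ht.le (right_mem_Icc.2 (hℓpos t ht.le).le)
    have h3 := hbcℓ t ht
    rw [h1, h2] at h3
    linear_combination h3
  have hpos : ∀ t ∈ interior (Icc t₀ t₁), 0 < t := fun t ht => by
    rw [interior_Icc] at ht
    exact ht₀.trans_lt ht.1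
  have hsubset : Icc t₀ t₁ ⊆ Ici 0 := fun t ht => ht₀.trans ht.1
  have hEanti : AntitoneOn E (Icc t₀ t₁) := by
    have hd : ∀ t ∈ Icc t₀ t₁, HasDerivWithinAt E
        (F (t + ℓ t) ^ 2 * (1 + ℓ' t) - F (t - ℓ t) ^ 2 * (1 - ℓ' t)) (Icc t₀ t₁) t :=
      fun t ht => ((hasDerivWithinAt_integral_sub_add hF2 (hℓd t (hsubset ht))).mono hsubset).congr
        (fun s hs => hEF s (hsubset hs)) (hEF t (hsubset ht))
    refine antitoneOn_of_hasDerivWithinAt_nonpos (convex_Icc _ _)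
      (fun t ht => (hd t ht).continuousWithinAt)
      (fun t ht => (hd t (interior_subset ht)).mono interior_subset) fun t ht => ?_
    have hx := hexp t (interior_subset ht)
    exact sub_nonpos.2 (flux_le_of_reflection hη0 hx.1.le hx.2 (hrefl t (hpos t ht)))
  refine ⟨hanti, hEanti, ?_⟩
  set w : ℝ → ℝ := fun s => φ' s * Real.exp (-(Real.log |γ|) * φ s)
  have hwpos : ∀ s, -L ≤ s → 0 < w s := fun s hs => mul_pos (hφpos s hs) (Real.exp_pos _)
  have hφ'cont : ContinuousOn φ' (Ici (-L)) :=
    (hφC1.continuousOn_derivWithin (uniqueDiffOn_Ici _) le_rfl).congr fun s hs =>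
      ((hφd s hs).derivWithin (uniqueDiffOn_Ici _ s hs)).symm
  have hwcont : ContinuousOn w (Ici (-L)) :=
    hφ'cont.mul (Real.continuous_exp.comp_continuousOn (continuousOn_const.mul hφC1.continuousOn))
  have hφmono : MonotoneOn φ (Ici (-L)) :=
    (strictMonoOn_of_hasDerivWithinAt_pos (convex_Ici _) hφC1.continuousOn
      (fun s hs => (hφd s (interior_subset hs)).mono interior_subset)
      (fun s hs => hφpos s (interior_subset hs))).monotoneOn
  have hJ : Icc (t₀ - ℓ t₀) (t₁ + ℓ t₁) ⊆ Ici (-L) := fun s hs => (hminus t₀ ht₀).trans hs.1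
  have hwanti : AntitoneOn w (Icc (t₀ - ℓ t₀) (t₁ + ℓ t₁)) := by
    intro r hr s hs hrs
    refine mul_le_mul (hanti hr hs hrs) (Real.exp_le_exp.2 ?_) (Real.exp_pos _).le
      (hφpos r (hJ hr)).le
    exact mul_le_mul_of_nonpos_left (hφmono (hJ hr) (hJ hs) hrs)
      (neg_nonpos.2 (Real.log_pos hγ1).le)
  let k : ℝ → ℝ := fun s => F (max s (-L)) ^ 2 / w (max s (-L))
  have hk : Continuous k := (hF2.comp (by fun_prop)).div
    (hwcont.comp_continuous (by fun_prop) fun s => mem_Ici.2 (le_max_right s (-L)))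
    fun s => (hwpos _ (le_max_right _ _)).ne'
  have hkeq : ∀ s, -L ≤ s → k s = F s ^ 2 / w s := fun s hs => by simp only [k, max_eq_left hs]
  let S : ℝ → ℝ := fun t => ∫ s in (t - ℓ t)..(t + ℓ t), k s
  have hSconst : ∀ t ∈ Icc t₀ t₁, S t = S t₀ := by
    have hd : ∀ t ∈ Icc t₀ t₁, HasDerivWithinAt S
        (k (t + ℓ t) * (1 + ℓ' t) - k (t - ℓ t) * (1 - ℓ' t)) (Icc t₀ t₁) t :=
      fun t ht => (hasDerivWithinAt_integral_sub_add hk (hℓd t (hsubset ht))).mono hsubset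
    have hzero : ∀ t ∈ interior (Icc t₀ t₁),
        k (t + ℓ t) * (1 + ℓ' t) - k (t - ℓ t) * (1 - ℓ' t) = 0 := by
      intro t ht
      have h0 := (hpos t ht).le
      rw [hkeq _ (hplus t h0), hkeq _ (hminus t h0), sub_eq_zero]
      refine flux_balance_of_reflection hη0 (hm t h0).1 (hφpos _ (hplus t h0))
        (hφpos _ (hminus t h0)) (Real.exp_pos _) (Real.exp_pos _) (hrefl t (hpos t ht))
        (hφ'rel t h0) ?_
      rw [hγ]
      exact sq_mul_exp_neg_log_abs_add_two hη0 hη1 (hMoore t h0)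
    have hcont : ContinuousOn S (Icc t₀ t₁) := fun t ht => (hd t ht).continuousWithinAt
    have hd' := fun t ht => (hd t (interior_subset ht)).mono (interior_subset (s := Icc t₀ t₁))
    have hSanti := antitoneOn_of_hasDerivWithinAt_nonpos (convex_Icc _ _) hcont hd'
      fun t ht => (hzero t ht).le
    have hSmono := monotoneOn_of_hasDerivWithinAt_nonneg (convex_Icc _ _) hcont hd'
      fun t ht => (hzero t ht).ge
    have h0 := left_mem_Icc.2 ht₀₁
    exact fun t ht => le_antisymm (hSanti h0 ht ht.1) (hSmono h0 ht ht.1)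
  have hbounds : ∀ t ∈ Icc t₀ t₁, w (t + ℓ t) * S t₀ ≤ E t ∧ E t ≤ w (t - ℓ t) * S t₀ := by
    intro t ht
    obtain ⟨h0, h1, h2, h3⟩ := hIcc t ht
    have hI : Icc (t - ℓ t) (t + ℓ t) ⊆ Icc (t₀ - ℓ t₀) (t₁ + ℓ t₁) := Icc_subset_Icc h1 h3
    rw [← hSconst t ht, hEF t h0]
    refine integral_antitoneOn_mul_bounds h2 hF2 hk (hwanti.mono hI) (fun s hs => ?_)
      fun s hs => ?_
    · exact div_nonneg (sq_nonneg _) (hwpos _ (le_max_right _ _)).le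
    · have := hwpos s (hJ (hI hs))
      rw [hkeq s (hJ (hI hs))]
      field_simp
  intro t ht
  have h0 := (hIcc t ht).1
  obtain ⟨hlo₀, hup₀⟩ := hbounds t₀ (left_mem_Icc.2 ht₀₁)
  obtain ⟨hlo, hup⟩ := hbounds t ht
  have hp := hwpos _ (hplus t h0)
  have hq := hwpos _ (hminus t h0)
  have hp₀ := hwpos _ (hplus t₀ ht₀)
  have hq₀ := hwpos _ (hminus t₀ ht₀)
  constructor
  · refine le_trans ?_ hlo
    change w (t + ℓ t) / w (t₀ - ℓ t₀) * E t₀ ≤ _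
    rw [div_mul_eq_mul_div, mul_div_assoc]
    exact mul_le_mul_of_nonneg_left ((div_le_iff₀' hq₀).2 hup₀) hp.le
  · refine hup.trans ?_
    change _ ≤ w (t - ℓ t) / w (t₀ + ℓ t₀) * E t₀
    rw [div_mul_eq_mul_div, mul_div_assoc]
    exact mul_le_mul_of_nonneg_left ((le_div_iff₀' hp₀).2 hlo₀) hq.le
end
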